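/- For every h ∈ C(J̃,ℝ), the family {G^m h : m ∈ ℤ₊} is equicontinuous on the compact metric space (J̃, d_X). -/

import Mathlib

open MeasureTheory Filter Topology Polynomial
open scoped OnePoint Classical ENNReal

noncomputable section

namespace SkewRational

/-- The Riemann sphere, modelled as the one-point compactification of `ℂ`. -/
abbrev Sphere : Type := OnePoint ℂ

/-- The product space `X = Σ_N⁺ × ℂ̂`. -/
abbrev SymX (N : ℕ) : Type := (ℕ → Fin N) × Sphere

variable {N : ℕ}

/-- The left shift on `Σ_N⁺`. -/
def shiftW (w : ℕ → Fin N) : ℕ → Fin N := fun n => w (n + 1)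

/-- Prepending a letter to an infinite word. -/
def consW (v : Fin N) (w : ℕ → Fin N) : ℕ → Fin N := fun n => if n = 0 then v else w (n - 1)

/-- Evaluation of the rational map `P/Q` (in irreducible form) on the Riemann sphere. -/
def ratEval (P Q : ℂ[X]) : Sphere → Sphere := fun z =>
  OnePoint.elim z
    (if Q.natDegree < P.natDegree then (OnePoint.infty : Sphere)
     else if P.natDegree < Q.natDegree then ((0 : ℂ) : Sphere)
     else ((P.leadingCoeff / Q.leadingCoeff : ℂ) : Sphere))
    (fun a => if Q.eval a = 0 then (OnePoint.infty : Sphere) else ((P.eval a / Q.eval a : ℂ) : Sphere))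

/-- The multiset of preimages (with multiplicity) of a point of the sphere under `P/Q`. -/
def fiber (P Q : ℂ[X]) (a : Sphere) : Multiset Sphere :=
  OnePoint.elim a
    ((Q.roots.map fun z => (z : Sphere)) +
      Multiset.replicate (max P.natDegree Q.natDegree - Q.natDegree) (OnePoint.infty : Sphere))
    (fun b =>
      (((P - Polynomial.C b * Q).roots.map fun z => (z : Sphere)) +
        Multiset.replicate
          (max P.natDegree Q.natDegree - (P - Polynomial.C b * Q).natDegree) (OnePoint.infty : Sphere)))

variable (p q : Fin N → ℂ[X])

/-- The degree `d_i` of the rational map `R_i = p i / q i`. -/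
def degR (i : Fin N) : ℕ := max (p i).natDegree (q i).natDegree

/-- `D = d₁ + ⋯ + d_N`. -/
def Dtot : ℕ := ∑ i, degR p q i

/-- Standing assumptions: `N ≥ 1`, each `R_i = p i / q i` in irreducible form, all degrees
at least `1`, and at least one degree at least `2`. -/
def Good : Prop :=
  1 ≤ N ∧ (∀ i, IsCoprime (p i) (q i)) ∧ (∀ i, 1 ≤ degR p q i) ∧ (∃ i, 2 ≤ degR p q i)

/-- The skew-product map `T(w, z) = (σ w, R_{w 0} z)`. -/
def Tmap : SymX N → SymX N := fun x => (shiftW x.1, ratEval (p (x.1 0)) (q (x.1 0)) x.2)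

/-- The multiset of preimages of a point under `T`, counted with multiplicity. -/
def preimT (x : SymX N) : Multiset (SymX N) :=
  ∑ v : Fin N, (fiber (p v) (q v) x.2).map fun z => (consW v x.1, z)

/-- The multiset of `n`-th order preimages under `T^n`, counted with multiplicity. -/
def preimTn : ℕ → SymX N → Multiset (SymX N)
  | 0, x => {x}
  | n + 1, x => (preimT p q x).bind fun y => preimTn n y

/-- The chordal (spherical) metric on the Riemann sphere. -/
def sphDist : Sphere → Sphere → ℝ := fun z w =>
  OnePoint.elim z
    (OnePoint.elim w 0 fun b => 2 / Real.sqrt (1 + ‖b‖ ^ 2))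
    (fun a =>
      OnePoint.elim w (2 / Real.sqrt (1 + ‖a‖ ^ 2))
        (fun b => 2 * dist a b / (Real.sqrt (1 + ‖a‖ ^ 2) * Real.sqrt (1 + ‖b‖ ^ 2))))

/-- The metric `d(w, w') = 2^{-n(w,w')}` on `Σ_N⁺`. -/
def shiftDist (w w' : ℕ → Fin N) : ℝ :=
  if h : ∃ n, w n ≠ w' n then (2 : ℝ)⁻¹ ^ (Nat.find h + 1) else 0

/-- The metric on `X`: maximum of the two coordinate metrics. -/
def dX : SymX N → SymX N → ℝ := fun x y => max (shiftDist x.1 y.1) (sphDist x.2 y.2)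

/-- Montel normality of a family of self-maps of the sphere on a set `U`. -/
def NormalOn (F : Set (Sphere → Sphere)) (U : Set Sphere) : Prop :=
  ∀ s : ℕ → Sphere → Sphere, (∀ n, s n ∈ F) →
    ∃ φ : ℕ → ℕ, StrictMono φ ∧ ∃ g : Sphere → Sphere,
      ∀ K : Set Sphere, K ⊆ U → IsCompact K → ∀ ε : ℝ, 0 < ε →
        ∀ᶠ n in atTop, ∀ z ∈ K, sphDist (s (φ n) z) (g z) < ε

/-- The compositions `R_{w (n-1)} ∘ ⋯ ∘ R_{w 0}`. -/
def itComp (w : ℕ → Fin N) : ℕ → Sphere → Sphere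
  | 0 => id
  | n + 1 => ratEval (p (w n)) (q (w n)) ∘ itComp w n

/-- The fibrewise Fatou set `F_w`. -/
def fatouW (w : ℕ → Fin N) : Set Sphere :=
  {z | ∃ U : Set Sphere, IsOpen U ∧ z ∈ U ∧
    NormalOn {g | ∃ n, 1 ≤ n ∧ g = itComp p q w n} U}

/-- The fibrewise Julia set `J_w`. -/
def juliaW (w : ℕ → Fin N) : Set Sphere := (fatouW p q w)ᶜ

/-- The Julia set `J̃` of the skew-product map `T`. -/
def juliaSet : Set (SymX N) :=
  closure (⋃ w : ℕ → Fin N, {w} ×ˢ juliaW p q w)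

/-- The critical points of `T`: `(w, z)` with `z` a critical point of `R_{w 0}`. -/
def critSet : Set (SymX N) :=
  {x | 2 ≤ (fiber (p (x.1 0)) (q (x.1 0))
        (ratEval (p (x.1 0)) (q (x.1 0)) x.2)).count x.2}

/-- Assumption (A1): no super-attracting periodic point of `T` lies in the Julia set
(a periodic point is super-attracting exactly when its orbit meets the critical set,
i.e. the derivative of the return composition vanishes). -/
def NoSuperAttract : Prop :=
  ∀ x ∈ juliaSet p q, ∀ m : ℕ, 1 ≤ m → (Tmap p q)^[m] x = x →
    ∀ k < m, (Tmap p q)^[k] x ∉ critSet p q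

instance : MeasurableSpace (SymX N) := borel _
instance : BorelSpace (SymX N) := ⟨rfl⟩

instance : MeasurableSpace ↥(juliaSet p q) := borel _
instance : BorelSpace ↥(juliaSet p q) := ⟨rfl⟩

/-! ### Fixed points counted with multiplicity -/

/-- Formal composition of rational maps as pairs of polynomials: `compPair a b = a ∘ b`. -/
def compPair (a b : ℂ[X] × ℂ[X]) : ℂ[X] × ℂ[X] :=
  (∑ i ∈ Finset.range (max a.1.natDegree a.2.natDegree + 1),
      Polynomial.C (a.1.coeff i) * b.1 ^ i * b.2 ^ (max a.1.natDegree a.2.natDegree - i),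
   ∑ i ∈ Finset.range (max a.1.natDegree a.2.natDegree + 1),
      Polynomial.C (a.2.coeff i) * b.1 ^ i * b.2 ^ (max a.1.natDegree a.2.natDegree - i))

/-- For a word `[v₁, …, v_m]`, the composite `R_{v_m} ∘ ⋯ ∘ R_{v₁}` as a pair of
polynomials. -/
def wordPair : List (Fin N) → ℂ[X] × ℂ[X]
  | [] => (Polynomial.X, 1)
  | v :: t => compPair (wordPair t) (p v, q v)

/-- The multiset of fixed points (with multiplicity) on the sphere of the rational map given
by a pair of polynomials; a degree-`k` map has `k + 1` fixed points with multiplicity. -/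
def fixMul (a : ℂ[X] × ℂ[X]) : Multiset Sphere :=
  ((a.1 - Polynomial.X * a.2).roots.map fun z => (z : Sphere)) +
    Multiset.replicate
      (max a.1.natDegree a.2.natDegree + 1 - (a.1 - Polynomial.X * a.2).natDegree) (OnePoint.infty : Sphere)

/-- The periodic word `(v₁ ⋯ v_m v₁ ⋯ v_m ⋯)`. -/
def perW {m : ℕ} (hm : 0 < m) (v : Fin m → Fin N) : ℕ → Fin N :=
  fun n => v ⟨n % m, Nat.mod_lt n hm⟩

/-- The multiset `Fix_m(T)` of fixed points of `T^m`, counted with multiplicity. -/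
def fixMultiset (m : ℕ) : Multiset (SymX N) :=
  if hm : 0 < m then
    ∑ v : Fin m → Fin N, (fixMul (wordPair p q (List.ofFn v))).map fun z => (perW hm v, z)
  else 0

/-! ### Thermodynamic formalism -/

/-- The ergodic (Birkhoff) sum `f^n`. -/
def birk (f : SymX N → ℝ) (n : ℕ) (y : SymX N) : ℝ :=
  ∑ k ∈ Finset.range n, f ((Tmap p q)^[k] y)

/-- `(L_f^n 1)(x) = Σ_{T^n y = x} e^{f^n(y)}`. -/
def LSum (f : SymX N → ℝ) (n : ℕ) (x : SymX N) : ℝ :=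
  ((preimTn p q n x).map fun y => Real.exp (birk p q f n y)).sum

/-- The pressure `P(f) = sup_{x ∈ J̃} limsup (1/n) log (L_f^n 1)(x)`. -/
def pressure (f : SymX N → ℝ) : ℝ :=
  ⨆ x : ↥(juliaSet p q), limsup (fun n : ℕ => (n : ℝ)⁻¹ * Real.log (LSum p q f n ↑x)) atTop

/-- Extension by zero of a function on `J̃` to all of `X`; since `T⁻¹ J̃ = J̃`, the values
outside `J̃` are irrelevant in all expressions below. -/
def jextend (f : ↥(juliaSet p q) → ℝ) : SymX N → ℝ :=
  fun x => if hx : x ∈ juliaSet p q then f ⟨x, hx⟩ else 0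

/-- Hölder continuity on `J̃` with respect to the metric `d_X`. -/
def HolderOnJ (f : ↥(juliaSet p q) → ℝ) : Prop :=
  ∃ C : ℝ, 0 < C ∧ ∃ α : ℝ, α ∈ Set.Ioc (0 : ℝ) 1 ∧
    ∀ x y : ↥(juliaSet p q), |f x - f y| ≤ C * dX (x : SymX N) (y : SymX N) ^ α

/-- `Q(g) = P(f + g) − P(f)`. -/
def Qfun (f g : ↥(juliaSet p q) → ℝ) : ℝ :=
  pressure p q (jextend p q fun x => f x + g x) - pressure p q (jextend p q f)

/-- The Legendre transform `L(m) = sup_g (∫ g dm − Q(g)) ∈ [0, (OnePoint.infty : Sphere)]`. -/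
def LLfun (f : ↥(juliaSet p q) → ℝ) (m : ProbabilityMeasure ↥(juliaSet p q)) : EReal :=
  ⨆ g : C(↥(juliaSet p q), ℝ),
    (((∫ x, g x ∂(m : Measure ↥(juliaSet p q))) - Qfun p q f g : ℝ) : EReal)

/-- `ρ(K) = inf_{m ∈ K} L(m)`. -/
def rho (f : ↥(juliaSet p q) → ℝ) (K : Set (ProbabilityMeasure ↥(juliaSet p q))) : EReal :=
  ⨅ m ∈ K, LLfun p q f m

/-- Membership in `M_T`: `T`-invariance of a probability measure on `J̃`. -/
def MTinv (m : ProbabilityMeasure ↥(juliaSet p q)) : Prop :=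
  ∀ A : Set (SymX N), MeasurableSet A →
    ((m : Measure ↥(juliaSet p q)).map Subtype.val) (Tmap p q ⁻¹' A) =
      ((m : Measure ↥(juliaSet p q)).map Subtype.val) A

/-- The orbital measure `μ_{y,n} = (1/n)(δ_y + δ_{Ty} + ⋯ + δ_{T^{n-1}y})`, viewed as a
measure on `J̃`. -/
def orbMeas (y : SymX N) (n : ℕ) : Measure ↥(juliaSet p q) :=
  Measure.comap Subtype.val
    ((n : ℝ≥0∞)⁻¹ • ∑ k ∈ Finset.range n, Measure.dirac ((Tmap p q)^[k] y))

/-- The (unique, if it exists) probability-measure avatar of `μ` lies in `K`. -/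
def inK (μ : Measure ↥(juliaSet p q)) (K : Set (ProbabilityMeasure ↥(juliaSet p q))) : Prop :=
  ∃ ν : ProbabilityMeasure ↥(juliaSet p q), (ν : Measure ↥(juliaSet p q)) = μ ∧ ν ∈ K

/-- The sequence `(1/n) log [Σ_{T^n y = x, μ_{y,n} ∈ K} e^{f^n(y)} / Σ_{T^n y = x} e^{f^n(y)}]`,
valued in `EReal` with the convention `log 0 = ⊥`. -/
def preimLDSeq (f : ↥(juliaSet p q) → ℝ) (x : SymX N)
    (K : Set (ProbabilityMeasure ↥(juliaSet p q))) : ℕ → EReal := fun n =>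
  if (((preimTn p q n x).filter fun y => inK p q (orbMeas p q y n) K).map
        fun y => Real.exp (birk p q (jextend p q f) n y)).sum = 0 then ⊥
  else
    (((n : ℝ)⁻¹ * Real.log
      (((((preimTn p q n x).filter fun y => inK p q (orbMeas p q y n) K).map
          fun y => Real.exp (birk p q (jextend p q f) n y)).sum) /
        LSum p q (jextend p q f) n x) : ℝ) : EReal)

/-- `Fix_m(T) ∩ J̃` as a multiset. -/
def fixJ (m : ℕ) : Multiset (SymX N) := (fixMultiset p q m).filter fun y => y ∈ juliaSet p q

/-- `Σ_{(ω,ζ) ∈ Fix_m(T) ∩ J̃} e^{f^m(ω,ζ)}`. -/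
def fixSum (f : SymX N → ℝ) (m : ℕ) : ℝ :=
  ((fixJ p q m).map fun y => Real.exp (birk p q f m y)).sum

/-- The periodic-point analogue of `preimLDSeq`, with the convention `log 0 = ⊥`. -/
def fixLDSeq (f : ↥(juliaSet p q) → ℝ)
    (K : Set (ProbabilityMeasure ↥(juliaSet p q))) : ℕ → EReal := fun m =>
  if (((fixJ p q m).filter fun y => inK p q (orbMeas p q y m) K).map
        fun y => Real.exp (birk p q (jextend p q f) m y)).sum = 0 then ⊥
  else
    (((m : ℝ)⁻¹ * Real.log
      (((((fixJ p q m).filter fun y => inK p q (orbMeas p q y m) K).map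
          fun y => Real.exp (birk p q (jextend p q f) m y)).sum) /
        fixSum p q (jextend p q f) m) : ℝ) : EReal)

/-! ### Inverse branches -/

/-- Projection of a subset of `X` to the sphere coordinate. -/
def projC (E : Set (SymX N)) : Set Sphere := Prod.snd '' E

/-- For a word `[v₁, …, v_m]`, the composite map `R_{v₁} ∘ R_{v₂} ∘ ⋯ ∘ R_{v_m}`. -/
def mapWord (l : List (Fin N)) : Sphere → Sphere :=
  l.foldr (fun i f => ratEval (p i) (q i) ∘ f) id

/-- `γ_m(U)`: the total number of analytic inverse branches of `T^m` on `U`, counted over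
all `m`-strings.  (A continuous section of a rational map off its critical values is
automatically holomorphic.) -/
def gammaCount (U : Set (SymX N)) (m : ℕ) : ℕ :=
  Nat.card ((v : Fin m → Fin N) ×
    { s : C(↥(projC U), Sphere) // ∀ z : ↥(projC U), mapWord p q (List.ofFn v) (s z) = ↑z })

/-- `C_n = ⋃_{k=1}^n T^k(C)`, the critical values of `T` of order up to `n`. -/
def critValSet (n : ℕ) : Set (SymX N) :=
  ⋃ k ∈ Finset.Icc 1 n, (Tmap p q)^[k] '' critSet p q

/-- `τ`: the number of distinct critical values of `T` in `U` (projected to the sphere). -/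
def tauCount (U : Set (SymX N)) : ℕ := (Prod.snd '' (Tmap p q '' critSet p q ∩ U)).ncard

/-! ### The averaging operator `G` -/

/-- `(G^m h)(x) = D^{-m} Σ_{T^m y = x} h(y)`. -/
def GmFun (h : SymX N → ℝ) (m : ℕ) (x : SymX N) : ℝ :=
  ((Dtot p q : ℝ) ^ m)⁻¹ * ((preimTn p q m x).map h).sum

/-- The supremum norm on functions on `J̃`. -/
def supJ (f : ↥(juliaSet p q) → ℝ) : ℝ := ⨆ x, |f x|


/-! ### Abstract fibre calculus on a compact metric space -/

section Abstract

variable {S : Type*} [MetricSpace S]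

/-- Product formula for a map `R` with fibres `fib` of cardinality `d`. -/
structure PF (R : S → S) (fib : S → Multiset S) (d : ℕ) : Prop where
  card : ∀ a, Multiset.card (fib a) = d
  pf : ∃ A B : S → ℝ, (∀ x, 0 < A x) ∧ (∀ x, 0 < B x) ∧
    ∀ x a, dist (R x) a = A x * B a * ((fib a).map (dist x)).prod

theorem exists_vec {α : Type*} {d : ℕ} (M : Multiset α) (h : Multiset.card M = d) :
    ∃ Y : Fin d → α, (Finset.univ.val.map Y) = M := by
  subst h
  induction M using Quotient.inductionOn with
  | h l =>
    refine ⟨fun i => l.get (Fin.cast (by simp) i), ?_⟩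
    rw [Fin.univ_val_map]
    simp

theorem prod_dist_eq_zero (M : Multiset S) (x : S) : (M.map (dist x)).prod = 0 ↔ x ∈ M := by
  rw [Multiset.prod_eq_zero_iff, Multiset.mem_map]
  constructor
  · rintro ⟨a, ha, h⟩
    rw [dist_eq_zero] at h
    rwa [h]
  · intro h
    exact ⟨x, h, dist_self x⟩

theorem prod_dist_nonneg (M : Multiset S) (x : S) : 0 ≤ (M.map (dist x)).prod := by
  apply Multiset.prod_nonneg
  intro a ha
  obtain ⟨y, _, rfl⟩ := Multiset.mem_map.1 ha
  exact dist_nonneg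

theorem prod_dist_cont (M : Multiset S) : Continuous fun x => (M.map (dist x)).prod := by
  induction M using Multiset.induction_on with
  | empty => simpa using continuous_const
  | cons a M ih =>
    simp only [Multiset.map_cons, Multiset.prod_cons]
    exact (continuous_id.dist continuous_const).mul ih

theorem mult_unique [∀ x : S, (𝓝[≠] x).NeBot] (M : Multiset S) :
    ∀ (M' : Multiset S) (c c' : ℝ), 0 < c → 0 < c' →
    (∀ x, c * (M.map (dist x)).prod = c' * (M'.map (dist x)).prod) → M = M' := by
  induction M using Multiset.induction_on with
  | empty =>
    intro M' c c' hc hc' h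
    by_contra hne
    obtain ⟨y, hy⟩ := Multiset.exists_mem_of_ne_zero (Ne.symm hne)
    have := h y
    rw [(prod_dist_eq_zero M' y).2 hy] at this
    simp at this
    exact hc.ne' this
  | cons y M ih =>
    intro M' c c' hc hc' h
    have h1 : y ∈ M' := by
      have := h y
      rw [(prod_dist_eq_zero (y ::ₘ M) y).2 (Multiset.mem_cons_self y M)] at this
      rw [← prod_dist_eq_zero]
      have h2 : c' * (M'.map (dist y)).prod = 0 := by rw [← this]; simp
      exact (mul_eq_zero.1 h2).resolve_left hc'.ne'
    obtain ⟨M'', rfl⟩ := Multiset.exists_cons_of_mem h1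
    congr 1
    refine ih M'' c c' hc hc' ?_
    have hd : Dense ({y}ᶜ : Set S) := dense_compl_singleton y
    have := Continuous.ext_on hd (f := fun x => c * (M.map (dist x)).prod)
      (g := fun x => c' * (M''.map (dist x)).prod)
      (continuous_const.mul (prod_dist_cont M)) (continuous_const.mul (prod_dist_cont M'')) ?_
    · intro x; exact congrFun this x
    · intro x hx
      have h3 := h x
      simp only [Multiset.map_cons, Multiset.prod_cons] at h3
      have h4 : dist x y ≠ 0 := by rw [dist_ne_zero]; exact hx
      apply mul_left_cancel₀ h4
      simp only
      linarith

theorem PF.mem_iff {R : S → S} {fib : S → Multiset S} {d : ℕ} (h : PF R fib d) (x a : S) :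
    x ∈ fib a ↔ R x = a := by
  obtain ⟨A, B, hA, hB, hf⟩ := h.pf
  rw [← prod_dist_eq_zero, ← dist_eq_zero (x := R x), hf]
  simp [(hA x).ne', (hB a).ne']

theorem PF.comp {R1 R2 : S → S} {f1 f2 : S → Multiset S} {d1 d2 : ℕ}
    (h1 : PF R1 f1 d1) (h2 : PF R2 f2 d2) :
    PF (R1 ∘ R2) (fun a => (f1 a).bind f2) (d1 * d2) := by
  refine ⟨fun a => ?_, ?_⟩
  · rw [Multiset.card_bind]
    simp [Function.comp_def, h2.card, h1.card]
  · obtain ⟨A1, B1, hA1, hB1, hf1⟩ := h1.pf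
    obtain ⟨A2, B2, hA2, hB2, hf2⟩ := h2.pf
    refine ⟨fun x => A1 (R2 x) * A2 x ^ d1, fun a => B1 a * ((f1 a).map B2).prod, ?_, ?_, ?_⟩
    · intro x; exact mul_pos (hA1 _) (pow_pos (hA2 _) _)
    · intro a; refine mul_pos (hB1 _) (Multiset.prod_pos ?_)
      intro b hb
      obtain ⟨y, _, rfl⟩ := Multiset.mem_map.1 hb
      exact hB2 y
    · intro x a
      have key : ∀ M : Multiset S, (M.map (dist (R2 x))).prod =
          A2 x ^ (Multiset.card M) * (M.map B2).prod * ((M.bind f2).map (dist x)).prod := by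
        intro M
        induction M using Multiset.induction_on with
        | empty => simp
        | cons y M ih =>
          rw [Multiset.map_cons, Multiset.prod_cons, ih, hf2]
          simp only [Multiset.map_cons, Multiset.prod_cons, Multiset.card_cons,
            Multiset.cons_bind, Multiset.map_add, Multiset.prod_add]
          ring
      simp only [Function.comp_apply]
      rw [hf1, key, h1.card]
      ring

/-- The graph of the fibre correspondence. -/
def fibGraph (fib : S → Multiset S) (d : ℕ) : Set (S × (Fin d → S)) :=
  {t | Finset.univ.val.map t.2 = fib t.1}

theorem prod_vec {d : ℕ} (Y : Fin d → S) (x : S) :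
    ((Finset.univ.val.map Y).map (dist x)).prod = ∏ i, dist x (Y i) := by
  rw [Multiset.map_map]; rfl

theorem fibGraph_closed [∀ x : S, (𝓝[≠] x).NeBot] {R : S → S} {fib : S → Multiset S} {d : ℕ}
    (h : PF R fib d) : IsClosed (fibGraph fib d) := by
  obtain ⟨A, B, hA, hB, hf⟩ := h.pf
  apply IsSeqClosed.isClosed
  rintro t ⟨z, Y⟩ ht hlim
  have hz : Tendsto (fun n => (t n).1) atTop (𝓝 z) := (continuous_fst.tendsto _).comp hlim
  have hY : Tendsto (fun n => (t n).2) atTop (𝓝 Y) := (continuous_snd.tendsto _).comp hlim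
  -- B (z n) * prod converges for each x
  have hF : ∀ x, Tendsto (fun n => ∏ i, dist x ((t n).2 i)) atTop (𝓝 (∏ i, dist x (Y i))) := by
    intro x
    apply tendsto_finsetProd
    intro i _
    exact tendsto_const_nhds.dist ((tendsto_pi_nhds.1 hY) i)
  have hE : ∀ x n, dist (R x) (t n).1 = A x * B (t n).1 * ∏ i, dist x ((t n).2 i) := by
    intro x n
    rw [hf, ← prod_vec, show Finset.univ.val.map (t n).2 = fib (t n).1 from ht n]
  have hD : ∀ x, Tendsto (fun n => dist (R x) (t n).1) atTop (𝓝 (dist (R x) z)) :=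
    fun x => tendsto_const_nhds.dist hz
  -- choose x avoiding finite sets
  have hfin : (((Finset.univ.val.map Y).toFinset ∪ (fib z).toFinset : Finset S) : Set S).Finite :=
    Finset.finite_toSet _
  obtain ⟨x0, hx0⟩ : ∃ x0 : S, x0 ∉ (((Finset.univ.val.map Y).toFinset ∪ (fib z).toFinset : Finset S) : Set S) := by
    have hne : (𝓝[≠] z).NeBot := inferInstance
    have := Dense.diff_finite (dense_univ (X := S)) hfin
    have hS : Nonempty S := ⟨z⟩
    obtain ⟨x, hx⟩ := this.nonempty
    exact ⟨x, hx.2⟩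
  have hx1 : x0 ∉ Finset.univ.val.map Y := by
    intro hh; apply hx0; simp only [Finset.coe_union, Set.mem_union, Finset.mem_coe, Multiset.mem_toFinset]; left; exact hh
  have hx2 : x0 ∉ fib z := by
    intro hh; apply hx0; simp only [Finset.coe_union, Set.mem_union, Finset.mem_coe, Multiset.mem_toFinset]; right; exact hh
  have hp0 : ∏ i, dist x0 (Y i) ≠ 0 := by
    rw [← prod_vec, Ne, prod_dist_eq_zero]; exact hx1
  set b := dist (R x0) z / (A x0 * ∏ i, dist x0 (Y i)) with hb
  have hbpos : 0 < b := by
    apply div_pos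
    · rw [dist_pos]; intro hh; exact hx2 ((h.mem_iff _ _).2 hh)
    · exact mul_pos (hA _) (lt_of_le_of_ne (Finset.prod_nonneg fun _ _ => dist_nonneg) hp0.symm)
  have hBlim : Tendsto (fun n => B (t n).1) atTop (𝓝 b) := by
    have h1 : Tendsto (fun n => dist (R x0) (t n).1 / (A x0 * ∏ i, dist x0 ((t n).2 i))) atTop (𝓝 b) :=
      (hD x0).div (tendsto_const_nhds.mul (hF x0)) (mul_ne_zero (hA _).ne' hp0)
    refine h1.congr' ?_
    have h2 : ∀ᶠ n in atTop, ∏ i, dist x0 ((t n).2 i) ≠ 0 := (hF x0).eventually_ne hp0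
    filter_upwards [h2] with n hn
    rw [hE]
    have := (hA x0).ne'
    field_simp
  have hfinal : ∀ x, b * ((Finset.univ.val.map Y).map (dist x)).prod = B z * ((fib z).map (dist x)).prod := by
    intro x
    have h1 : Tendsto (fun n => dist (R x) (t n).1) atTop (𝓝 (A x * b * ∏ i, dist x (Y i))) := by
      have := (tendsto_const_nhds (x := A x)).mul hBlim |>.mul (hF x)
      refine this.congr fun n => (hE x n).symm
    have h2 := tendsto_nhds_unique h1 (hD x)
    rw [hf, ← prod_vec] at h2
    have := (hA x).ne'
    apply mul_left_cancel₀ this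
    linarith
  exact mult_unique _ _ b (B z) hbpos (hB z) hfinal

variable [CompactSpace S]

theorem fibGraph_compact [∀ x : S, (𝓝[≠] x).NeBot] {R : S → S} {fib : S → Multiset S} {d : ℕ}
    (h : PF R fib d) : IsCompact (fibGraph fib d) := (fibGraph_closed h).isCompact

theorem PF.continuous [∀ x : S, (𝓝[≠] x).NeBot] {R : S → S} {fib : S → Multiset S} {d : ℕ}
    (h : PF R fib d) : Continuous R := by
  rw [← continuousOn_univ, continuousOn_univ, continuous_iff_isClosed]
  intro C hC
  have : R ⁻¹' C = ⋃ i : Fin d, (fun t : S × (Fin d → S) => t.2 i) '' (fibGraph fib d ∩ Prod.fst ⁻¹' C) := by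
    ext x
    simp only [Set.mem_preimage, Set.mem_iUnion, Set.mem_image, Set.mem_inter_iff, Prod.exists]
    constructor
    · intro hx
      obtain ⟨Y, hY⟩ := exists_vec (fib (R x)) (h.card _)
      have : x ∈ Finset.univ.val.map Y := by rw [hY, h.mem_iff]
      obtain ⟨i, _, hi⟩ := Multiset.mem_map.1 this
      exact ⟨i, R x, Y, ⟨hY, hx⟩, hi⟩
    · rintro ⟨i, a, Y, ⟨hY, ha⟩, rfl⟩
      have : Y i ∈ fib a := by
        rw [← show Finset.univ.val.map Y = fib a from hY]
        exact Multiset.mem_map_of_mem _ (Finset.mem_univ_val i)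
      rw [(h.mem_iff _ _).1 this]
      exact ha
  rw [this]
  apply isClosed_iUnion_of_finite
  intro i
  apply IsCompact.isClosed
  exact ((fibGraph_compact h).inter_right (hC.preimage continuous_fst)).image
    ((continuous_apply i).comp continuous_snd)

theorem PF.isOpenMap [∀ x : S, (𝓝[≠] x).NeBot] {R : S → S} {fib : S → Multiset S} {d : ℕ}
    (h : PF R fib d) : IsOpenMap R := by
  intro U hU
  rw [← isClosed_compl_iff]
  have : (R '' U)ᶜ = Prod.fst '' (fibGraph fib d ∩ {t | ∀ i, t.2 i ∈ Uᶜ}) := by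
    ext a
    simp only [Set.mem_compl_iff, Set.mem_image, Set.mem_inter_iff, Prod.exists, Set.mem_ofPred_eq,
      exists_and_right, exists_eq_right]
    constructor
    · intro ha
      obtain ⟨Y, hY⟩ := exists_vec (fib a) (h.card _)
      refine ⟨Y, hY, fun i hi => ha ⟨Y i, hi, ?_⟩⟩
      rw [← h.mem_iff, ← hY]
      exact Multiset.mem_map_of_mem _ (Finset.mem_univ_val i)
    · rintro ⟨Y, hY, hU'⟩ ⟨x, hx, rfl⟩
      have : x ∈ Finset.univ.val.map Y := by
        rw [show Finset.univ.val.map Y = fib (R x) from hY, h.mem_iff]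
      obtain ⟨i, _, rfl⟩ := Multiset.mem_map.1 this
      exact hU' i hx
  rw [this]
  apply IsCompact.isClosed
  refine ((fibGraph_compact h).inter_right ?_).image continuous_fst
  rw [Set.ofPred_forall]
  refine isClosed_iInter fun i => ?_
  exact hU.isClosed_compl.preimage ((continuous_apply i).comp continuous_snd)

/-- Continuity of fibre sums with a compact parameter. -/
theorem PF.continuous_sum [∀ x : S, (𝓝[≠] x).NeBot] {R : S → S} {fib : S → Multiset S} {d : ℕ}
    (h : PF R fib d) {W : Type*} [TopologicalSpace W] [CompactSpace W] [T2Space W]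
    (k : W × S → ℝ) (hk : Continuous k) :
    Continuous fun x : W × S => ((fib x.2).map fun y => k (x.1, y)).sum := by
  rw [continuous_iff_isClosed]
  intro C hC
  have : (fun x : W × S => ((fib x.2).map fun y => k (x.1, y)).sum) ⁻¹' C =
      (fun t : W × (S × (Fin d → S)) => (t.1, t.2.1)) ''
        ((Set.univ ×ˢ fibGraph fib d) ∩ {t | ∑ i, k (t.1, t.2.2 i) ∈ C}) := by
    ext ⟨w, z⟩
    simp only [Set.mem_preimage, Set.mem_image, Set.mem_inter_iff, Prod.exists, Set.mem_prod,
      Set.mem_univ, true_and, Set.mem_ofPred_eq, Prod.mk.injEq]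
    constructor
    · intro hx
      obtain ⟨Y, hY⟩ := exists_vec (fib z) (h.card _)
      refine ⟨w, z, Y, ⟨hY, ?_⟩, rfl, rfl⟩
      rw [← hY, Multiset.map_map] at hx
      exact hx
    · rintro ⟨w', z', Y, ⟨hY, hs⟩, rfl, rfl⟩
      rw [← show Finset.univ.val.map Y = fib z' from hY, Multiset.map_map]
      exact hs
  rw [this]
  apply IsCompact.isClosed
  refine IsCompact.image (IsCompact.inter_right (isCompact_univ.prod (fibGraph_compact h)) ?_) (by fun_prop)
  refine hC.preimage ?_
  fun_prop

theorem PF.lower [∀ x : S, (𝓝[≠] x).NeBot] (hd1 : ∀ x y : S, dist x y ≤ 1) (z0 : S)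
    {R : S → S} {fib : S → Multiset S} {d : ℕ}
    (h : PF R fib d) (hd : 1 ≤ d) : ∃ c : ℝ, 0 < c ∧ ∀ x a, c * ((fib a).map (dist x)).prod ≤ dist (R x) a := by
  obtain ⟨A, B, hA, hB, hf⟩ := h.pf
  have : Nonempty S := ⟨z0⟩
  have hle : ∀ x a, ((fib a).map (dist x)).prod ≤ 1 := by
    intro x a
    obtain ⟨Y, hY⟩ := exists_vec (fib a) (h.card _)
    rw [← hY, prod_vec]
    exact Finset.prod_le_one (fun _ _ => dist_nonneg) (fun _ _ => hd1 _ _)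
  -- two distinct points
  obtain ⟨z1, hz1⟩ : ∃ z1 : S, z1 ≠ z0 := (dense_compl_singleton z0).nonempty
  have hdp : 0 < dist z1 z0 := dist_pos.2 hz1
  -- preimages
  have hsurj : ∀ a, ∃ x, R x = a := by
    intro a
    have : 0 < Multiset.card (fib a) := by rw [h.card]; omega
    obtain ⟨x, hx⟩ := Multiset.card_pos_iff_exists_mem.1 this
    exact ⟨x, (h.mem_iff _ _).1 hx⟩
  have hAl : ∀ x, dist z1 z0 / 2 / max (B z0) (B z1) ≤ A x := by
    intro x
    have h0 : dist (R x) z0 ≤ A x * B z0 := by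
      rw [hf]
      exact mul_le_of_le_one_right (mul_pos (hA _) (hB _)).le (hle _ _)
    have h1 : dist (R x) z1 ≤ A x * B z1 := by
      rw [hf]
      exact mul_le_of_le_one_right (mul_pos (hA _) (hB _)).le (hle _ _)
    have h2 : dist z1 z0 ≤ dist (R x) z1 + dist (R x) z0 := by
      rw [dist_comm (R x) z1]; exact dist_triangle _ _ _
    have hm : 0 < max (B z0) (B z1) := lt_max_of_lt_left (hB _)
    rw [div_le_iff₀ hm]
    have h3 : A x * B z0 ≤ A x * max (B z0) (B z1) := mul_le_mul_of_nonneg_left (le_max_left _ _) (hA _).le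
    have h4 : A x * B z1 ≤ A x * max (B z0) (B z1) := mul_le_mul_of_nonneg_left (le_max_right _ _) (hA _).le
    linarith
  obtain ⟨x0, hx0⟩ := hsurj z0
  obtain ⟨x1, hx1⟩ := hsurj z1
  have hBl : ∀ a, dist z1 z0 / 2 / max (A x0) (A x1) ≤ B a := by
    intro a
    have h0 : dist z0 a ≤ A x0 * B a := by
      rw [← hx0, hf]
      exact mul_le_of_le_one_right (mul_pos (hA _) (hB _)).le (hle _ _)
    have h1 : dist z1 a ≤ A x1 * B a := by
      rw [← hx1, hf]
      exact mul_le_of_le_one_right (mul_pos (hA _) (hB _)).le (hle _ _)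
    have h2 : dist z1 z0 ≤ dist z1 a + dist z0 a := by
      rw [dist_comm z0 a]; exact dist_triangle _ _ _
    have hm : 0 < max (A x0) (A x1) := lt_max_of_lt_left (hA _)
    rw [div_le_iff₀ hm]
    have h3 : A x0 * B a ≤ max (A x0) (A x1) * B a := mul_le_mul_of_nonneg_right (le_max_left _ _) (hB _).le
    have h4 : A x1 * B a ≤ max (A x0) (A x1) * B a := mul_le_mul_of_nonneg_right (le_max_right _ _) (hB _).le
    linarith
  set α := dist z1 z0 / 2 / max (B z0) (B z1)
  set β := dist z1 z0 / 2 / max (A x0) (A x1)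
  have hα : 0 < α := div_pos (by linarith) (lt_max_of_lt_left (hB _))
  have hβ : 0 < β := div_pos (by linarith) (lt_max_of_lt_left (hA _))
  refine ⟨α * β, mul_pos hα hβ, fun x a => ?_⟩
  rw [hf]
  apply mul_le_mul_of_nonneg_right _ (prod_dist_nonneg _ _)
  exact mul_le_mul (hAl x) (hBl a) hβ.le (hA x).le

/-- Compact families of `d`-tuples with multiplicities at most `k`. -/
theorem compact_mult (hd1 : ∀ x y : S, dist x y ≤ 1) {d : ℕ} (hd : 1 ≤ d) (k : ℕ)
    (K : Set (Fin d → S)) (hK : IsCompact K)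
    (hm : ∀ Y ∈ K, ∀ x, (Finset.univ.filter fun i => Y i = x).card ≤ k) :
    ∃ c : ℝ, 0 < c ∧ ∀ Y ∈ K, ∀ x, ∃ i, c * dist x (Y i) ^ k ≤ ∏ j, dist x (Y j) := by
  -- for each subset `I` of size `k+1`, a positive lower bound
  have h1 : ∀ I : Finset (Fin d), I.card = k + 1 → ∃ δ : ℝ, 0 < δ ∧ ∀ Y ∈ K, ∀ x,
      δ ≤ ∑ i ∈ I, dist x (Y i) := by
    intro I hI
    have hc : IsCompact (K ×ˢ (Set.univ : Set S)) := hK.prod isCompact_univ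
    have hcont : ContinuousOn (fun t : (Fin d → S) × S => ∑ i ∈ I, dist t.2 (t.1 i))
        (K ×ˢ (Set.univ : Set S)) := by
      apply Continuous.continuousOn; fun_prop
    have hpos : ∀ t ∈ K ×ˢ (Set.univ : Set S), 0 < ∑ i ∈ I, dist t.2 (t.1 i) := by
      rintro ⟨Y, x⟩ ⟨hY, _⟩
      by_contra hcon
      have h0 : ∑ i ∈ I, dist x (Y i) = 0 :=
        le_antisymm (not_lt.1 hcon) (Finset.sum_nonneg fun _ _ => dist_nonneg)
      rw [Finset.sum_eq_zero_iff_of_nonneg fun _ _ => dist_nonneg] at h0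
      have h2 : I ⊆ Finset.univ.filter fun i => Y i = x := by
        intro i hi
        simp only [Finset.mem_filter, Finset.mem_univ, true_and]
        exact (dist_eq_zero.1 (h0 i hi)).symm
      have := Finset.card_le_card h2
      have := hm Y hY x
      omega
    obtain ⟨δ, hδ, h⟩ := hc.exists_forall_le' hcont hpos
    exact ⟨δ, hδ, fun Y hY x => h (Y, x) ⟨hY, trivial⟩⟩
  choose! δ hδ hδ' using h1
  obtain ⟨ε, hε, hε1, hεI⟩ : ∃ ε : ℝ, 0 < ε ∧ ε ≤ 1 ∧ ∀ I : Finset (Fin d), I.card = k + 1 → ε * (k + 1) ≤ δ I := by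
    have : ∀ s : Finset (Finset (Fin d)), ∃ ε : ℝ, 0 < ε ∧ ε ≤ 1 ∧ ∀ I ∈ s, I.card = k + 1 → ε * (k + 1) ≤ δ I := by
      intro s
      induction s using Finset.induction_on with
      | empty => exact ⟨1, one_pos, le_rfl, by simp⟩
      | insert I s _ ih =>
        obtain ⟨ε, h0, h1, h2⟩ := ih
        by_cases hI : I.card = k + 1
        · refine ⟨min ε (δ I / (k + 1)), lt_min h0 (div_pos (hδ I hI) (by positivity)), (min_le_left _ _).trans h1, ?_⟩
          intro I' hI' hc
          have hk : (0 : ℝ) < k + 1 := by positivity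
          rcases Finset.mem_insert.1 hI' with rfl | hI'
          · rw [← le_div_iff₀ hk]; exact min_le_right _ _
          · refine le_trans ?_ (h2 I' hI' hc)
            exact mul_le_mul_of_nonneg_right (min_le_left _ _) hk.le
        · refine ⟨ε, h0, h1, ?_⟩
          intro I' hI' hc
          rcases Finset.mem_insert.1 hI' with rfl | hI'
          · exact absurd hc hI
          · exact h2 I' hI' hc
    obtain ⟨ε, a, b, c⟩ := this Finset.univ
    exact ⟨ε, a, b, fun I => c I (Finset.mem_univ _)⟩
  refine ⟨ε ^ d, pow_pos hε d, fun Y hY x => ?_⟩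
  have : Nonempty (Fin d) := ⟨⟨0, hd⟩⟩
  obtain ⟨i, _, hi⟩ := Finset.exists_min_image Finset.univ (fun i => dist x (Y i)) Finset.univ_nonempty
  refine ⟨i, ?_⟩
  set near := Finset.univ.filter fun j => dist x (Y j) < ε with hnear
  have hcard : near.card ≤ k := by
    by_contra hcon
    obtain ⟨I, hI, hIc⟩ := Finset.exists_subset_card_eq (n := k + 1) (s := near) (by omega)
    have h2 := hδ' I hIc Y hY x
    have h3 : ∑ i ∈ I, dist x (Y i) < ∑ i ∈ I, ε := by
      apply Finset.sum_lt_sum_of_nonempty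
      · rw [← Finset.card_pos]; omega
      · intro j hj
        exact (Finset.mem_filter.1 (hI hj)).2
    rw [Finset.sum_const, hIc, nsmul_eq_mul] at h3
    have h4 := hεI I hIc
    push_cast at h3
    linarith
  rw [← Finset.prod_filter_mul_prod_filter_not Finset.univ (fun j => dist x (Y j) < ε), mul_comm]
  apply mul_le_mul _ _ (by positivity) (Finset.prod_nonneg fun _ _ => dist_nonneg)
  · calc dist x (Y i) ^ k ≤ dist x (Y i) ^ near.card := pow_le_pow_of_le_one dist_nonneg (hd1 _ _) hcard
      _ = ∏ j ∈ near, dist x (Y i) := by rw [Finset.prod_const]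
      _ ≤ _ := Finset.prod_le_prod (fun _ _ => dist_nonneg) (fun j _ => hi j (Finset.mem_univ _))
  · calc ε ^ d ≤ ε ^ (Finset.univ.filter fun j => ¬ dist x (Y j) < ε).card := by
          apply pow_le_pow_of_le_one hε.le hε1
          exact (Finset.card_le_univ _).trans (by simp)
      _ = ∏ j ∈ Finset.univ.filter (fun j => ¬ dist x (Y j) < ε), ε := by rw [Finset.prod_const]
      _ ≤ _ := Finset.prod_le_prod (fun _ _ => hε.le) (fun j hj => by
          have := (Finset.mem_filter.1 hj).2; linarith)

end Abstract


/-! ### Words and abstract dynamics -/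

section Words

variable {S : Type*} [MetricSpace S]

def RW (R : Fin N → S → S) : List (Fin N) → S → S
  | [] => id
  | v :: t => R v ∘ RW R t

def fibW (fib : Fin N → S → Multiset S) : List (Fin N) → S → Multiset S
  | [] => fun z => {z}
  | v :: t => fun z => (fib v z).bind (fibW fib t)

def consAll : List (Fin N) → (ℕ → Fin N) → (ℕ → Fin N)
  | [] => id
  | v :: t => fun w => consAll t (consW v w)

def dW (d : Fin N → ℕ) (l : List (Fin N)) : ℕ := (l.map d).prod

def TT (R : Fin N → S → S) : (ℕ → Fin N) × S → (ℕ → Fin N) × S :=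
  fun x => (shiftW x.1, R (x.1 0) x.2)

theorem PF.idd : PF (id : S → S) (fun z => {z}) 1 := by
  refine ⟨fun a => by simp, fun _ => 1, fun _ => 1, fun _ => one_pos, fun _ => one_pos, fun x a => by simp⟩

theorem PF.word {R : Fin N → S → S} {fib : Fin N → S → Multiset S} {d : Fin N → ℕ}
    (h : ∀ v, PF (R v) (fib v) (d v)) (l : List (Fin N)) : PF (RW R l) (fibW fib l) (dW d l) := by
  induction l with
  | nil => simpa [RW, fibW, dW] using PF.idd
  | cons v t ih => simpa [RW, fibW, dW] using PF.comp (h v) ih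

theorem RW_append (R : Fin N → S → S) (l1 l2 : List (Fin N)) (x : S) :
    RW R (l1 ++ l2) x = RW R l1 (RW R l2 x) := by
  induction l1 with
  | nil => rfl
  | cons v t ih => simp [RW, ih]

theorem shiftW_consW (v : Fin N) (w : ℕ → Fin N) : shiftW (consW v w) = w := by
  funext n; simp [shiftW, consW]

theorem TT_consW (R : Fin N → S → S) (v : Fin N) (w : ℕ → Fin N) (z : S) :
    TT R (consW v w, z) = (w, R v z) := by
  simp [TT, shiftW_consW]; simp [consW]

theorem TT_consAll (R : Fin N → S → S) (l : List (Fin N)) (w : ℕ → Fin N) (y : S) :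
    (TT R)^[l.length] (consAll l w, y) = (w, RW R l y) := by
  induction l generalizing w with
  | nil => rfl
  | cons v t ih =>
    rw [List.length_cons, Function.iterate_succ_apply']
    simp only [consAll]
    rw [ih, TT_consW]; rfl

theorem consAll_snoc (a : List (Fin N)) (v : Fin N) (w : ℕ → Fin N) :
    consAll (a ++ [v]) w = consW v (consAll a w) := by
  induction a generalizing w with
  | nil => rfl
  | cons u t ih => simp [consAll, ih]

theorem consW_continuous (v : Fin N) : Continuous (consW v) := by
  refine continuous_pi fun n => ?_
  unfold consW
  by_cases h : n = 0
  · simp [h]; exact continuous_const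
  · simp [h]; exact continuous_apply _

theorem consAll_continuous (l : List (Fin N)) : Continuous (consAll l) := by
  induction l with
  | nil => exact continuous_id
  | cons v t ih => exact ih.comp (consW_continuous v)

theorem consAll_agree (l : List (Fin N)) (w1 w2 : ℕ → Fin N) (j : ℕ)
    (h : ∀ n < j, w1 n = w2 n) : ∀ n < j + l.length, consAll l w1 n = consAll l w2 n := by
  induction l generalizing w1 w2 j with
  | nil => simpa [consAll] using h
  | cons v t ih =>
    intro n hn
    simp only [consAll]
    refine ih (consW v w1) (consW v w2) (j+1) ?_ n (by simp at hn; omega)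
    intro k hk
    unfold consW
    split_ifs with h0
    · rfl
    · exact h _ (by omega)

theorem consAll_iter_agree (l : List (Fin N)) (hl : 1 ≤ l.length) (w1 w2 : ℕ → Fin N) (k : ℕ) :
    ∀ n < k, (consAll l)^[k] w1 n = (consAll l)^[k] w2 n := by
  induction k with
  | zero => intro n hn; omega
  | succ k ih =>
    intro n hn
    rw [Function.iterate_succ_apply', Function.iterate_succ_apply']
    exact consAll_agree l _ _ k ih n (by omega)

/-- Existence of the periodic limit word. -/
theorem exists_per (l : List (Fin N)) (hl : 1 ≤ l.length) (w : ℕ → Fin N) :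
    ∃ W, consAll l W = W ∧ Tendsto (fun k => (consAll l)^[k] w) atTop (𝓝 W) := by
  have ht : Tendsto (fun k => (consAll l)^[k] w) atTop (𝓝 fun n => (consAll l)^[n+1] w n) := by
    rw [tendsto_pi_nhds]
    intro n
    refine tendsto_const_nhds.congr' ?_
    filter_upwards [eventually_ge_atTop (n+1)] with k hk
    obtain ⟨j, rfl⟩ := Nat.exists_eq_add_of_le hk
    rw [Function.iterate_add_apply _ (n+1) j]
    exact consAll_iter_agree l hl _ _ (n+1) n (by omega)
  refine ⟨_, ?_, ht⟩
  have h1 := ((consAll_continuous l).tendsto _).comp ht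
  have h2 := (tendsto_add_atTop_iff_nat 1).2 ht
  refine tendsto_nhds_unique h1 (h2.congr fun k => ?_)
  rw [Function.iterate_succ_apply']; rfl

structure Dyn (R : Fin N → S → S) (fib : Fin N → S → Multiset S) (d : Fin N → ℕ)
    (J : Set ((ℕ → Fin N) × S)) (Fc : Finset S) : Prop where
  pf : ∀ v, PF (R v) (fib v) (d v)
  hd : ∀ v, 1 ≤ d v
  back : ∀ x, TT R x ∈ J → x ∈ J
  closed : IsClosed J
  fin : ∀ v z, 2 ≤ (fib v (R v z)).count z → z ∈ Fc
  a1 : ∀ x ∈ J, ∀ m, 1 ≤ m → (TT R)^[m] x = x →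
    ¬ 2 ≤ (fib (x.1 0) (R (x.1 0) x.2)).count x.2

section D
variable {R : Fin N → S → S} {fib : Fin N → S → Multiset S} {d : Fin N → ℕ}
    {J : Set ((ℕ → Fin N) × S)} {Fc : Finset S}

theorem Dyn.backW (H : Dyn R fib d J Fc) (l : List (Fin N)) (w : ℕ → Fin N) (y : S)
    (h : (w, RW R l y) ∈ J) : (consAll l w, y) ∈ J := by
  induction l generalizing w with
  | nil => exact h
  | cons v t ih =>
    refine ih (consW v w) (H.back _ ?_)
    rw [TT_consW]; exact h

theorem Dyn.noper (H : Dyn R fib d J Fc) (a : List (Fin N)) (v : Fin N) (w : ℕ → Fin N) (c : S)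
    (h : (w, c) ∈ J) (hc : RW R (a ++ [v]) c = c) : ¬ 2 ≤ (fib v (R v c)).count c := by
  have hl : 1 ≤ (a ++ [v]).length := by simp
  obtain ⟨W, hW, ht⟩ := exists_per (a ++ [v]) hl w
  have hk : ∀ k, ((consAll (a ++ [v]))^[k] w, c) ∈ J := by
    intro k
    induction k with
    | zero => exact h
    | succ k ih =>
      rw [Function.iterate_succ_apply']
      exact H.backW _ _ _ (by rw [hc]; exact ih)
  have hJ : (W, c) ∈ J :=
    H.closed.mem_of_tendsto (ht.prodMk_nhds tendsto_const_nhds) (Eventually.of_forall hk)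
  have := H.a1 _ hJ _ hl (by
    have h1 := TT_consAll R (a ++ [v]) W c
    rw [hW, hc] at h1; exact h1)
  have h0 : W 0 = v := by
    rw [← hW, consAll_snoc]; simp [consW]
  simpa [h0] using this

def CS (R : Fin N → S → S) (fib : Fin N → S → Multiset S) : List (Fin N) → S → Finset S
  | [], _ => ∅
  | v :: t, y => if 2 ≤ (fib v (R v (RW R t y))).count (RW R t y) then insert (RW R t y) (CS R fib t y)
      else CS R fib t y

theorem CS_mem (t : List (Fin N)) (y c : S) (h : c ∈ CS R fib t y) :
    ∃ a v b, t = a ++ v :: b ∧ RW R b y = c ∧ 2 ≤ (fib v (R v c)).count c := by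
  induction t with
  | nil => simp [CS] at h
  | cons v t ih =>
    have hr : c ∈ CS R fib t y → ∃ a v' b, v :: t = a ++ v' :: b ∧ RW R b y = c ∧
        2 ≤ (fib v' (R v' c)).count c := by
      intro h
      obtain ⟨a, v', b, h1, h2, h3⟩ := ih h
      exact ⟨v :: a, v', b, by simp [h1], h2, h3⟩
    unfold CS at h
    split_ifs at h with hc
    · rcases Finset.mem_insert.1 h with rfl | h
      · exact ⟨[], v, t, rfl, rfl, hc⟩
      · exact hr h
    · exact hr h

theorem count_bind_one {α β : Type*} (M : Multiset α) (f : α → Multiset β) (y : β) (u : α)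
    (h : ∀ a, a ≠ u → y ∉ f a) : (M.bind f).count y = M.count u * (f u).count y := by
  induction M using Multiset.induction_on with
  | empty => simp
  | cons a M ih =>
    rw [Multiset.cons_bind, Multiset.count_add, ih, Multiset.count_cons]
    by_cases ha : a = u
    · subst ha; simp; ring
    · rw [Multiset.count_eq_zero_of_notMem (h a ha)]; simp [Ne.symm ha]

theorem Dyn.mem_fibW (H : Dyn R fib d J Fc) (l : List (Fin N)) (x a : S) :
    x ∈ fibW fib l a ↔ RW R l x = a := (PF.word H.pf l).mem_iff x a

theorem Dyn.count_le (H : Dyn R fib d J Fc) (dm : ℕ) (hdm : ∀ v, d v ≤ dm) (hdm1 : 1 ≤ dm)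
    (l : List (Fin N)) (w : ℕ → Fin N) (y : S) (h : (w, RW R l y) ∈ J) :
    CS R fib l y ⊆ Fc ∧ (fibW fib l (RW R l y)).count y ≤ dm ^ (CS R fib l y).card := by
  induction l generalizing w with
  | nil => simp [CS, fibW, RW]
  | cons v t ih =>
    have hJ : (consW v w, RW R t y) ∈ J := H.back _ (by rw [TT_consW]; exact h)
    obtain ⟨h1, h2⟩ := ih _ hJ
    have hcnt : (fibW fib (v :: t) (RW R (v :: t) y)).count y =
        (fib v (R v (RW R t y))).count (RW R t y) * (fibW fib t (RW R t y)).count y := by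
      simp only [fibW, RW, Function.comp]
      refine count_bind_one _ _ _ _ ?_
      intro a ha hy
      exact ha ((H.mem_fibW _ _ _).1 hy).symm
    rw [hcnt]
    unfold CS
    split_ifs with hc
    · refine ⟨Finset.insert_subset (H.fin _ _ hc) h1, ?_⟩
      have hn : RW R t y ∉ CS R fib t y := by
        intro hm
        obtain ⟨a, v', b, e, h3, h4⟩ := CS_mem _ _ _ hm
        refine H.noper a v' _ _ hJ ?_ h4
        conv_lhs => rw [← h3]
        rw [← RW_append]
        rw [e]; simp
      rw [Finset.card_insert_of_notMem hn, pow_succ, mul_comm]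
      refine Nat.mul_le_mul h2 (((Multiset.count_le_card _ _).trans (le_of_eq ((H.pf v).card _))).trans (hdm v))
    · refine ⟨h1, ?_⟩
      calc _ ≤ 1 * (fibW fib t (RW R t y)).count y := Nat.mul_le_mul_right _ (by omega)
        _ ≤ _ := by simpa using h2

variable [CompactSpace S] [∀ x : S, (𝓝[≠] x).NeBot]

theorem Dyn.step (H : Dyn R fib d J Fc) (hd1 : ∀ x y : S, dist x y ≤ 1) (z0 : S)
    (dm : ℕ) (hdm : ∀ v, d v ≤ dm) (hdm1 : 1 ≤ dm)
    (l : List (Fin N)) : ∃ c : ℝ, 0 < c ∧ ∀ w z, (w, z) ∈ J → ∀ x, ∃ y ∈ fibW fib l z,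
      c * dist x y ^ (dm ^ Fc.card) ≤ dist (RW R l x) z := by
  have hpf := PF.word H.pf l
  have hdl : 1 ≤ dW d l := by
    unfold dW
    induction l with
    | nil => simp
    | cons v t ih =>
      simp only [List.map_cons, List.prod_cons]
      exact Nat.mul_pos (H.hd v) (ih (PF.word H.pf t))
  obtain ⟨c1, hc1, h1⟩ := hpf.lower hd1 z0 hdl
  have hJc : IsCompact J := H.closed.isCompact
  have hK : IsCompact (Prod.snd '' (fibGraph (fibW fib l) (dW d l) ∩ Prod.fst ⁻¹' (Prod.snd '' J))) := by
    refine ((fibGraph_compact hpf).inter_right ?_).image continuous_snd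
    exact (hJc.image continuous_snd).isClosed.preimage continuous_fst
  obtain ⟨c2, hc2, h2⟩ := compact_mult hd1 hdl (dm ^ Fc.card) _ hK (by
    rintro Y ⟨⟨z, Y⟩, ⟨hg, ⟨⟨w, z'⟩, hJ, hz⟩⟩, rfl⟩ x
    simp only at hz; subst hz
    simp only [fibGraph, Set.mem_setOf_eq] at hg
    have e : (Finset.univ.filter fun i => Y i = x).card = (fibW fib l z').count x := by
      rw [← hg, Multiset.count_map]
      rw [Finset.card_def, Finset.filter_val]
      congr 1
      refine Multiset.filter_congr fun i _ => ⟨fun h => h.symm, fun h => h.symm⟩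
    simp only
    rw [e]
    by_cases hx : RW R l x = z'
    · subst hx
      obtain ⟨h3, h4⟩ := H.count_le dm hdm hdm1 l w x hJ
      exact h4.trans (Nat.pow_le_pow_right hdm1 (Finset.card_le_card h3))
    · rw [Multiset.count_eq_zero_of_notMem (fun hm => hx ((H.mem_fibW _ _ _).1 hm))]
      exact Nat.zero_le _)
  refine ⟨c1 * c2, mul_pos hc1 hc2, fun w z hz x => ?_⟩
  obtain ⟨Y, hY⟩ := exists_vec (fibW fib l z) (hpf.card _)
  obtain ⟨i, hi⟩ := h2 Y ⟨(z, Y), ⟨hY, ⟨(w, z), hz, rfl⟩⟩, rfl⟩ x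
  refine ⟨Y i, ?_, ?_⟩
  · rw [← hY]; exact Multiset.mem_map_of_mem _ (Finset.mem_univ i)
  · refine le_trans ?_ (h1 x z)
    rw [mul_assoc]
    refine mul_le_mul_of_nonneg_left ?_ hc1.le
    rw [← hY, prod_vec]; exact hi

theorem Dyn.stepL (H : Dyn R fib d J Fc) (hd1 : ∀ x y : S, dist x y ≤ 1) (z0 : S)
    (dm : ℕ) (hdm : ∀ v, d v ≤ dm) (hdm1 : 1 ≤ dm) (L : ℕ) :
    ∃ c : ℝ, 0 < c ∧ c ≤ 1 ∧ ∀ l : List (Fin N), l.length ≤ L → ∀ w z, (w, z) ∈ J → ∀ x,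
      ∃ y ∈ fibW fib l z, c * dist x y ^ (dm ^ Fc.card) ≤ dist (RW R l x) z := by
  choose c hc h using H.step hd1 z0 dm hdm hdm1
  have hf : {l : List (Fin N) | l.length ≤ L}.Finite := List.finite_length_le _ _
  obtain ⟨c0, hc0, hle⟩ : ∃ c0 : ℝ, 0 < c0 ∧ ∀ l : List (Fin N), l.length ≤ L → c0 ≤ c l := by
    have hne : {l : List (Fin N) | l.length ≤ L}.Nonempty := ⟨[], by simp⟩
    obtain ⟨l0, hl0, hmin⟩ := Set.exists_min_image _ c hf hne
    exact ⟨c l0, hc _, fun l hl => hmin l hl⟩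
  refine ⟨min c0 1, lt_min hc0 one_pos, min_le_right _ _, fun l hl w z hz x => ?_⟩
  obtain ⟨y, hy, hle'⟩ := h l w z hz x
  refine ⟨y, hy, le_trans ?_ hle'⟩
  exact mul_le_mul_of_nonneg_right ((min_le_left _ _).trans (hle l hl)) (by positivity)

theorem Dyn.stepN (H : Dyn R fib d J Fc) (L K : ℕ) (hK : 1 ≤ K) (c : ℝ) (hc : 0 < c) (hc1 : c ≤ 1)
    (h : ∀ l : List (Fin N), l.length ≤ L → ∀ w z, (w, z) ∈ J → ∀ x,
      ∃ y ∈ fibW fib l z, c * dist x y ^ K ≤ dist (RW R l x) z) (n : ℕ) :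
    ∀ l : List (Fin N), l.length ≤ n * L → ∀ w z, (w, z) ∈ J → ∀ x,
      ∃ y ∈ fibW fib l z, (c ^ n * dist x y) ^ (K ^ n) ≤ dist (RW R l x) z := by
  induction n with
  | zero =>
    intro l hl w z hz x
    have : l = [] := by simpa using hl
    subst this
    exact ⟨z, by simp [fibW], by simp [RW]⟩
  | succ n ih =>
    intro l hl w z hz x
    obtain ⟨y1, hy1, h1⟩ := h (l.take L) (by simp) w z hz (RW R (l.drop L) x)
    have e1 := (H.mem_fibW _ _ _).1 hy1
    have hJ : (consAll (l.take L) w, y1) ∈ J := H.backW _ _ _ (by rw [e1]; exact hz)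
    obtain ⟨y, hy, h2⟩ := ih (l.drop L) (by simp; rw [add_mul] at hl; omega) _ _ hJ x
    have e2 := (H.mem_fibW _ _ _).1 hy
    refine ⟨y, ?_, ?_⟩
    · rw [H.mem_fibW, ← List.take_append_drop L l, RW_append, e2, e1]
    · rw [← RW_append, List.take_append_drop] at h1
      refine le_trans ?_ h1
      have hd := dist_nonneg (x := x) (y := y)
      have hk1 : K ^ (n+1) ≠ 0 := by positivity
      calc (c ^ (n+1) * dist x y) ^ (K ^ (n+1))
          = c ^ (K ^ (n+1)) * (((c ^ n * dist x y)) ^ (K ^ n)) ^ K := by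
            rw [← pow_mul, ← pow_succ, pow_succ c n, ← mul_pow]; ring
        _ ≤ c * dist (RW R (l.drop L) x) y1 ^ K := by
            gcongr
            exact pow_le_of_le_one hc.le hc1 hk1

end D
end Words


section Pot
variable {S : Type*} [MetricSpace S]

structure Nice (ν : Measure ℝ) (X : ℝ → S) (C : ℝ) : Prop where
  prob : IsProbabilityMeasure ν
  cont : Continuous X
  ne : ∀ y, ∀ᵐ ω ∂ν, X ω ≠ y
  int : ∀ y, Integrable (fun ω => (√(dist (X ω) y))⁻¹) ν
  bd : ∀ y, ∫ ω, (√(dist (X ω) y))⁻¹ ∂ν ≤ C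

theorem log_aux (t : ℝ) (ht : 0 < t) (B : ℝ) (hB : 0 < B) :
    - Real.log t ≤ 2 * ((√t)⁻¹ / B + Real.log B) := by
  have hs : 0 < √t := Real.sqrt_pos.2 ht
  have h1 := Real.log_le_sub_one_of_pos (x := (√t)⁻¹ / B) (by positivity)
  rw [Real.log_div (by positivity) hB.ne', Real.log_inv, Real.log_sqrt ht.le] at h1
  linarith

theorem Nice.logint {ν : Measure ℝ} {X : ℝ → S} {C : ℝ} (hX : Nice ν X C)
    (hd1 : ∀ x y : S, dist x y ≤ 1) (y : S) : Integrable (fun ω => Real.log (dist (X ω) y)) ν := by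
  refine Integrable.mono' ((hX.int y).const_mul 2) ?_ ?_
  · exact (Real.measurable_log.comp ((hX.cont.dist continuous_const).measurable)).aestronglyMeasurable
  · filter_upwards [hX.ne y] with ω hω
    have hp := dist_pos.2 hω
    rw [Real.norm_eq_abs, abs_of_nonpos (Real.log_nonpos hp.le (hd1 _ _))]
    simpa using log_aux _ hp 1 one_pos

variable {R : Fin N → S → S} {fib : Fin N → S → Multiset S} {d : Fin N → ℕ}
    {J : Set ((ℕ → Fin N) × S)} {Fc : Finset S}

theorem Dyn.dW_pos (H : Dyn R fib d J Fc) (l : List (Fin N)) : 1 ≤ dW d l := by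
  unfold dW
  induction l with
  | nil => simp
  | cons v t ih =>
    simp only [List.map_cons, List.prod_cons]
    exact Nat.mul_pos (H.hd v) ih

theorem dW_le (dm : ℕ) (hdm : ∀ v, d v ≤ dm) (l : List (Fin N)) : dW d l ≤ dm ^ l.length := by
  unfold dW
  induction l with
  | nil => simp
  | cons v t ih =>
    simp only [List.map_cons, List.prod_cons, List.length_cons, pow_succ]
    rw [mul_comm]
    exact Nat.mul_le_mul ih (hdm v)

variable [CompactSpace S] [∀ x : S, (𝓝[≠] x).NeBot]

theorem Dyn.intbound (H : Dyn R fib d J Fc) (hd1 : ∀ x y : S, dist x y ≤ 1)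
    (dm : ℕ) (hdm : ∀ v, d v ≤ dm) (hdm1 : 1 ≤ dm)
    (K n : ℕ) (hK : 1 ≤ K) (c : ℝ) (hc : 0 < c) (hc1 : c ≤ 1) (l : List (Fin N)) (z : S)
    (h : ∀ x, ∃ y ∈ fibW fib l z, (c ^ n * dist x y) ^ (K ^ n) ≤ dist (RW R l x) z)
    {ν : Measure ℝ} {X : ℝ → S} {C : ℝ} (hX : Nice ν X C) :
    Integrable (fun ω => Real.log (dist (RW R l (X ω)) z)) ν ∧
    |∫ ω, Real.log (dist (RW R l (X ω)) z) ∂ν| ≤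
      (K:ℝ) ^ n * (n * (-Real.log c) + 2 * (C + l.length * Real.log dm)) := by
  have := hX.prob
  have hpf := PF.word H.pf l
  have hB : (1:ℝ) ≤ (dW d l : ℝ) := by exact_mod_cast H.dW_pos l
  obtain ⟨Y, hY⟩ := exists_vec (fibW fib l z) (hpf.card _)
  set B : ℝ := (dW d l : ℝ) with hBdef
  set F : ℝ → ℝ := fun ω => (K:ℝ) ^ n * (n * (-Real.log c) +
    2 * ((∑ i, (√(dist (X ω) (Y i)))⁻¹) / B + Real.log B)) with hF
  have hint : Integrable (fun ω => ∑ i, (√(dist (X ω) (Y i)))⁻¹) ν :=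
    integrable_finsetSum _ fun i _ => hX.int (Y i)
  have hFint : Integrable F ν := by
    exact ((integrable_const _).add (((hint.div_const _).add (integrable_const _)).const_mul 2)).const_mul _
  have hlogc : 0 ≤ - Real.log c := by linarith [Real.log_nonpos hc.le hc1]
  have hptw : ∀ᵐ ω ∂ν, |Real.log (dist (RW R l (X ω)) z)| ≤ F ω := by
    have hne : ∀ᵐ ω ∂ν, ∀ i, X ω ≠ Y i := ae_all_iff.2 fun i => hX.ne (Y i)
    filter_upwards [hne] with ω hω
    obtain ⟨y, hy, hle⟩ := h (X ω)
    rw [← hY] at hy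
    obtain ⟨i, -, rfl⟩ := Multiset.mem_map.1 hy
    have hp := dist_pos.2 (hω i)
    have hp2 : 0 < (c ^ n * dist (X ω) (Y i)) ^ (K ^ n) := by positivity
    rw [abs_of_nonpos (Real.log_nonpos dist_nonneg (hd1 _ _))]
    have h1 := Real.log_le_log hp2 hle
    rw [Real.log_pow, Real.log_mul (by positivity) hp.ne', Real.log_pow] at h1
    push_cast at h1
    have h2 := log_aux _ hp B (by linarith)
    have h3 : (√(dist (X ω) (Y i)))⁻¹ ≤ ∑ i, (√(dist (X ω) (Y i)))⁻¹ :=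
      Finset.single_le_sum (f := fun i => (√(dist (X ω) (Y i)))⁻¹) (fun j _ => by positivity) (Finset.mem_univ i)
    have h4 : (√(dist (X ω) (Y i)))⁻¹ / B ≤ (∑ i, (√(dist (X ω) (Y i)))⁻¹) / B :=
      div_le_div_of_nonneg_right h3 (by linarith)
    calc - Real.log (dist (RW R l (X ω)) z) ≤ (K:ℝ)^n * (n * (-Real.log c) + -Real.log (dist (X ω) (Y i))) := by
          linarith
      _ ≤ F ω := by
          refine mul_le_mul_of_nonneg_left ?_ (by positivity)
          linarith
  have hmeas : AEStronglyMeasurable (fun ω => Real.log (dist (RW R l (X ω)) z)) ν :=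
    (Real.measurable_log.comp (((hpf.continuous.comp hX.cont).dist continuous_const).measurable)).aestronglyMeasurable
  refine ⟨Integrable.mono' hFint hmeas hptw, ?_⟩
  have h5 : |∫ ω, Real.log (dist (RW R l (X ω)) z) ∂ν| ≤ ∫ ω, F ω ∂ν := by
    rw [← Real.norm_eq_abs]
    exact norm_integral_le_of_norm_le hFint hptw
  refine h5.trans ?_
  have h6 : ∫ ω, F ω ∂ν = (K:ℝ) ^ n * (n * (-Real.log c) +
    2 * ((∑ i, ∫ ω, (√(dist (X ω) (Y i)))⁻¹ ∂ν) / B + Real.log B)) := by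
    simp only [hF]
    have hi2 : Integrable (fun ω => 2 * ((∑ i, (√(dist (X ω) (Y i)))⁻¹) / B + Real.log B)) ν :=
      ((hint.div_const _).add (integrable_const _)).const_mul 2
    rw [integral_const_mul, integral_add (integrable_const _) hi2,
      integral_const_mul 2, integral_add (hint.div_const _) (integrable_const _), integral_div,
      integral_finsetSum _ fun i _ => hX.int (Y i)]
    simp
  rw [h6]
  have h7 : (∑ i, ∫ ω, (√(dist (X ω) (Y i)))⁻¹ ∂ν) / B ≤ C := by
    rw [div_le_iff₀ (by linarith)]
    calc _ ≤ ∑ i : Fin (dW d l), C := Finset.sum_le_sum fun i _ => hX.bd (Y i)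
      _ = C * B := by simp [hBdef, mul_comm]
  have h8 : Real.log B ≤ l.length * Real.log dm := by
    rw [← Real.log_pow]
    refine Real.log_le_log (by linarith) ?_
    rw [hBdef]; exact_mod_cast dW_le dm hdm l
  refine mul_le_mul_of_nonneg_left ?_ (by positivity)
  linarith

theorem Dyn.diff_eq (H : Dyn R fib d J Fc) (hd1 : ∀ x y : S, dist x y ≤ 1) (l : List (Fin N)) :
    ∃ B : S → ℝ, ∀ (ν : Measure ℝ) (X : ℝ → S) (C : ℝ), Nice ν X C → ∀ z z' : S,
      Integrable (fun ω => Real.log (dist (RW R l (X ω)) z)) ν →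
      Integrable (fun ω => Real.log (dist (RW R l (X ω)) z')) ν →
      (∫ ω, Real.log (dist (RW R l (X ω)) z) ∂ν) - (∫ ω, Real.log (dist (RW R l (X ω)) z') ∂ν) =
      B z - B z' + ((fibW fib l z).map fun y => ∫ ω, Real.log (dist (X ω) y) ∂ν).sum
        - ((fibW fib l z').map fun y => ∫ ω, Real.log (dist (X ω) y) ∂ν).sum := by
  have hpf := PF.word H.pf l
  obtain ⟨A, B, hA, hB, hf⟩ := hpf.pf
  refine ⟨fun z => Real.log (B z), fun ν X C hX z z' hz hz' => ?_⟩
  have := hX.prob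
  obtain ⟨Y, hY⟩ := exists_vec (fibW fib l z) (hpf.card _)
  obtain ⟨Y', hY'⟩ := exists_vec (fibW fib l z') (hpf.card _)
  have key : ∀ z (Y : Fin (dW d l) → S), Finset.univ.val.map Y = fibW fib l z → ∀ᵐ ω ∂ν, Real.log (dist (RW R l (X ω)) z) =
      Real.log (A (X ω)) + Real.log (B z) + ∑ i, Real.log (dist (X ω) (Y i)) := by
    intro z Y hY
    have hne : ∀ᵐ ω ∂ν, ∀ i, X ω ≠ Y i := ae_all_iff.2 fun i => hX.ne (Y i)
    filter_upwards [hne] with ω hω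
    have hp : ∀ i, dist (X ω) (Y i) ≠ 0 := fun i => dist_ne_zero.2 (hω i)
    rw [hf, ← hY, prod_vec, Real.log_mul (mul_pos (hA _) (hB _)).ne' (Finset.prod_ne_zero_iff.2 fun i _ => hp i),
      Real.log_mul (hA _).ne' (hB _).ne', Real.log_prod (fun i _ => hp i)]
  have hI : ∀ Y : Fin (dW d l) → S, Integrable (fun ω => ∑ i, Real.log (dist (X ω) (Y i))) ν := fun Y =>
    integrable_finsetSum _ fun i _ => hX.logint hd1 (Y i)
  rw [← integral_sub hz hz']
  have : ∀ᵐ ω ∂ν, Real.log (dist (RW R l (X ω)) z) - Real.log (dist (RW R l (X ω)) z') =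
      (Real.log (B z) - Real.log (B z')) + (∑ i, Real.log (dist (X ω) (Y i)) - ∑ i, Real.log (dist (X ω) (Y' i))) := by
    filter_upwards [key z Y hY, key z' Y' hY'] with ω h1 h2
    rw [h1, h2]; ring
  have hi3 : Integrable (fun ω => ∑ i, Real.log (dist (X ω) (Y i)) - ∑ i, Real.log (dist (X ω) (Y' i))) ν :=
    (hI Y).sub (hI Y')
  rw [integral_congr_ae this, integral_add (integrable_const _) hi3, integral_sub (hI Y) (hI Y'),
    integral_finsetSum _ fun i _ => hX.logint hd1 (Y i), integral_finsetSum _ fun i _ => hX.logint hd1 (Y' i)]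
  rw [← hY, ← hY']
  simp only [Multiset.map_map, Function.comp_def, integral_const, probReal_univ, one_smul, smul_eq_mul, one_mul]
  simp only [Finset.sum]
  ring

/-- Growth comparison. -/
theorem growth (θ a b ε : ℝ) (hθ : 1 < θ) (hε : 0 < ε) :
    ∃ m0 : ℕ, ∀ m ≥ m0, θ ^ m * (a * m + b) ≤ ε * (θ ^ 2) ^ m := by
  have h1 := (tendsto_pow_const_div_const_pow_of_one_lt 1 hθ).const_mul a
  have h0 := (tendsto_pow_const_div_const_pow_of_one_lt 0 hθ).const_mul b
  have h := h1.add h0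
  simp only [mul_zero, add_zero] at h
  have h2 := h.eventually (gt_mem_nhds hε)
  obtain ⟨m0, hm0⟩ := eventually_atTop.1 h2
  refine ⟨m0, fun m hm => ?_⟩
  have h3 := hm0 m hm
  have hp : 0 < θ ^ m := by positivity
  have h4 : (a * m + b) ≤ ε * θ ^ m := by
    have : a * ((m:ℝ)^1 / θ^m) + b * ((m:ℝ)^0/θ^m) = (a * m + b) / θ ^ m := by
      field_simp
    rw [this, div_lt_iff₀ hp] at h3
    exact h3.le
  calc θ ^ m * (a * m + b) ≤ θ ^ m * (ε * θ ^ m) := mul_le_mul_of_nonneg_left h4 hp.le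
    _ = ε * (θ ^ 2) ^ m := by rw [← pow_mul, mul_comm 2 m, pow_mul]; ring

theorem Dyn.main (H : Dyn R fib d J Fc) (hd1 : ∀ x y : S, dist x y ≤ 1) (z0 : S)
    (ρ : ℝ) (hρ : 1 < ρ) (C ε : ℝ) (hε : 0 < ε) :
    ∃ m0 : ℕ, ∀ l : List (Fin N), m0 ≤ l.length → ∀ x ∈ J, ∀ x' ∈ J,
      ∀ (ν₁ : Measure ℝ) (X₁ : ℝ → S) (ν₂ : Measure ℝ) (X₂ : ℝ → S), Nice ν₁ X₁ C → Nice ν₂ X₂ C →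
      |((fibW fib l x.2).map fun y => (∫ ω, Real.log (dist (X₁ ω) y) ∂ν₁) -
          ∫ ω, Real.log (dist (X₂ ω) y) ∂ν₂).sum -
       ((fibW fib l x'.2).map fun y => (∫ ω, Real.log (dist (X₁ ω) y) ∂ν₁) -
          ∫ ω, Real.log (dist (X₂ ω) y) ∂ν₂).sum| ≤ ε * ρ ^ l.length := by
  set dm : ℕ := 1 + ∑ v, d v with hdmdef
  have hdm1 : 1 ≤ dm := by omega
  have hdm : ∀ v, d v ≤ dm := fun v =>
    (Finset.single_le_sum (f := d) (fun _ _ => Nat.zero_le _) (Finset.mem_univ v)).trans (by omega)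
  set K := dm ^ Fc.card with hKdef
  have hK : 1 ≤ K := Nat.one_le_pow _ _ hdm1
  set θ := √ρ with hθdef
  have hθ : 1 < θ := by rw [hθdef, Real.lt_sqrt] <;> norm_num; exact hρ
  have hθ2 : θ ^ 2 = ρ := Real.sq_sqrt (by linarith)
  obtain ⟨L, hL⟩ := pow_unbounded_of_one_lt (K:ℝ) hθ
  obtain ⟨c, hc, hc1, hst⟩ := H.stepL hd1 z0 dm hdm hdm1 (L+1)
  have hlogc : 0 ≤ - Real.log c := by linarith [Real.log_nonpos hc.le hc1]
  have hlogd : 0 ≤ Real.log dm := Real.log_nonneg (by exact_mod_cast hdm1)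
  obtain ⟨m0, hm0⟩ := growth θ (4 * θ^(L+1) * ((-Real.log c) + 2 * Real.log dm))
    (4 * θ^(L+1) * ((-Real.log c) + 2 * |C|)) ε hθ hε
  refine ⟨m0, fun l hl x hx x' hx' ν₁ X₁ ν₂ X₂ h₁ h₂ => ?_⟩
  set n := l.length / (L+1) + 1 with hn
  have hln : l.length ≤ n * (L+1) := by
    have := Nat.lt_div_mul_add (a := l.length) (b := L+1) (by omega)
    rw [hn, add_mul]; omega
  have hnl : n ≤ l.length + 1 := by rw [hn]; have := Nat.div_le_self l.length (L+1); omega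
  have hst' := H.stepN (L+1) K hK c hc hc1 hst n l hln
  have hβ : (K:ℝ) ^ n * (n * (-Real.log c) + 2 * (C + l.length * Real.log dm)) ≤
      θ ^ (L+1) * θ ^ l.length * ((l.length + 1) * (-Real.log c) + 2 * (|C| + l.length * Real.log dm)) := by
    have hnl' : (n:ℝ) ≤ l.length + 1 := by exact_mod_cast hnl
    have hKθ : (K:ℝ) ^ n ≤ θ ^ (L+1) * θ ^ l.length := by
      calc (K:ℝ)^n ≤ (θ^(L+1))^n := by
            refine pow_le_pow_left₀ (by positivity) (hL.le.trans ?_) _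
            exact pow_le_pow_right₀ hθ.le (by omega)
        _ = θ ^ ((L+1)*n) := by rw [pow_mul]
        _ ≤ θ ^ (L+1+l.length) := by
            refine pow_le_pow_right₀ hθ.le ?_
            rw [hn, mul_add, mul_one]
            have := Nat.mul_div_le l.length (L+1)
            omega
        _ = _ := by rw [pow_add]
    have h1 : (n:ℝ) * (-Real.log c) + 2 * (C + l.length * Real.log dm) ≤
        ((l.length + 1) * (-Real.log c) + 2 * (|C| + l.length * Real.log dm)) := by
      have := mul_le_mul_of_nonneg_right hnl' hlogc
      have := le_abs_self C
      linarith
    refine mul_le_mul hKθ h1 ?_ (by positivity) |>.trans le_rfl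
    have hC : 0 ≤ C := le_trans (integral_nonneg fun ω => by positivity) (h₁.bd z0)
    positivity
  have h3 := hm0 l.length hl
  rw [hθ2] at h3
  set β := (K:ℝ) ^ n * (n * (-Real.log c) + 2 * (C + l.length * Real.log dm))
  have h4 : 4 * β ≤ ε * ρ ^ l.length := by
    refine le_trans ?_ h3
    refine (mul_le_mul_of_nonneg_left hβ (by norm_num)).trans (le_of_eq ?_)
    ring
  obtain ⟨i1, b1⟩ := H.intbound hd1 dm hdm hdm1 K n hK c hc hc1 l x.2 (hst' x.1 x.2 hx) h₁
  obtain ⟨i2, b2⟩ := H.intbound hd1 dm hdm hdm1 K n hK c hc hc1 l x'.2 (hst' x'.1 x'.2 hx') h₁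
  obtain ⟨i3, b3⟩ := H.intbound hd1 dm hdm hdm1 K n hK c hc hc1 l x.2 (hst' x.1 x.2 hx) h₂
  obtain ⟨i4, b4⟩ := H.intbound hd1 dm hdm hdm1 K n hK c hc hc1 l x'.2 (hst' x'.1 x'.2 hx') h₂
  obtain ⟨B, hB⟩ := H.diff_eq hd1 l
  have e1 := hB ν₁ X₁ C h₁ x.2 x'.2 i1 i2
  have e2 := hB ν₂ X₂ C h₂ x.2 x'.2 i3 i4
  rw [Multiset.sum_map_sub, Multiset.sum_map_sub]
  rw [abs_le] at *
  constructor <;> linarith [b1.1, b1.2, b2.1, b2.2, b3.1, b3.2, b4.1, b4.2]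

end Pot


/-! ### The chordal metric -/

section Chordal

def hx1 (x : Sphere) : ℂ := OnePoint.elim x 1 fun a => a
def hx2 (x : Sphere) : ℂ := OnePoint.elim x 0 fun _ => 1
def vN (a b : ℂ) : ℝ := √(‖a‖ ^ 2 + ‖b‖ ^ 2)
def wg (x y : Sphere) : ℝ := ‖hx1 x * hx2 y - hx2 x * hx1 y‖
def NN (x : Sphere) : ℝ := vN (hx1 x) (hx2 x)
def chi (x y : Sphere) : ℝ := wg x y / (NN x * NN y)

theorem vN_tri (α β u1 u2 t1 t2 : ℂ) :
    vN (α * u1 + β * t1) (α * u2 + β * t2) ≤ ‖α‖ * vN u1 u2 + ‖β‖ * vN t1 t2 := by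
  have e : ∀ a b : ℂ, vN a b = ‖(!₂[a, b] : EuclideanSpace ℂ (Fin 2))‖ := by
    intro a b; rw [EuclideanSpace.norm_eq]; simp [vN]
  rw [e, e, e, ← norm_smul, ← norm_smul]
  refine le_trans (le_of_eq ?_) (norm_add_le _ _)
  congr 1
  ext i; fin_cases i <;> simp

theorem vN_smul (α u1 u2 : ℂ) : vN (α * u1) (α * u2) = ‖α‖ * vN u1 u2 := by
  unfold vN
  rw [norm_mul, norm_mul, mul_pow, mul_pow, ← mul_add, Real.sqrt_mul (by positivity), Real.sqrt_sq (norm_nonneg _)]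

theorem vN_pos {a b : ℂ} (h : ¬ (a = 0 ∧ b = 0)) : 0 < vN a b := by
  unfold vN
  apply Real.sqrt_pos.2
  by_cases ha : a = 0
  · have hb : b ≠ 0 := fun hb => h ⟨ha, hb⟩
    have := norm_pos_iff.2 hb
    positivity
  · have := norm_pos_iff.2 ha
    positivity

theorem NN_pos (x : Sphere) : 0 < NN x := by
  refine vN_pos ?_
  induction x using OnePoint.rec <;> simp [hx1, hx2]

@[simp] theorem hx1_coe (a : ℂ) : hx1 (a : Sphere) = a := rfl
@[simp] theorem hx2_coe (a : ℂ) : hx2 (a : Sphere) = 1 := rfl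
@[simp] theorem hx1_inf : hx1 (OnePoint.infty : Sphere) = 1 := rfl
@[simp] theorem hx2_inf : hx2 (OnePoint.infty : Sphere) = 0 := rfl

theorem NN_coe (a : ℂ) : NN (a : Sphere) = √(1 + ‖a‖ ^ 2) := by
  simp [NN, vN, add_comm]
theorem NN_inf : NN (OnePoint.infty : Sphere) = 1 := by
  simp [NN, vN]
theorem wg_coe (a b : ℂ) : wg a b = dist a b := by simp [wg, dist_eq_norm]

theorem sphDist_eq (x y : Sphere) : sphDist x y = 2 * chi x y := by
  induction x using OnePoint.rec with
  | infty =>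
    induction y using OnePoint.rec with
    | infty => simp [sphDist, chi, wg]
    | coe b => simp [sphDist, chi, wg, NN_coe, NN_inf]; ring
  | coe a =>
    induction y using OnePoint.rec with
    | infty => simp [sphDist, chi, wg, NN_coe, NN_inf]; ring
    | coe b => simp [sphDist, chi, wg_coe, NN_coe]; ring

theorem chi_self (x : Sphere) : chi x x = 0 := by
  simp [chi, wg, mul_comm]

theorem chi_comm (x y : Sphere) : chi x y = chi y x := by
  unfold chi
  rw [mul_comm (NN x)]
  congr 1
  unfold wg
  rw [← norm_neg]; congr 1; ring

theorem chi_tri (x y z : Sphere) : chi x z ≤ chi x y + chi y z := by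
  have h := vN_tri (hx1 y * hx2 z - hx2 y * hx1 z) (hx1 x * hx2 y - hx2 x * hx1 y)
    (hx1 x) (hx2 x) (hx1 z) (hx2 z)
  have e1 : (hx1 y * hx2 z - hx2 y * hx1 z) * hx1 x + (hx1 x * hx2 y - hx2 x * hx1 y) * hx1 z
    = (hx1 x * hx2 z - hx2 x * hx1 z) * hx1 y := by ring
  have e2 : (hx1 y * hx2 z - hx2 y * hx1 z) * hx2 x + (hx1 x * hx2 y - hx2 x * hx1 y) * hx2 z
    = (hx1 x * hx2 z - hx2 x * hx1 z) * hx2 y := by ring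
  rw [e1, e2, vN_smul] at h
  change wg x z * NN y ≤ wg y z * NN x + wg x y * NN z at h
  have hx := NN_pos x
  have hy := NN_pos y
  have hz := NN_pos z
  have e3 : chi x z = (wg x z * NN y) / (NN x * NN y * NN z) := by unfold chi; field_simp
  have e4 : chi x y + chi y z = (wg y z * NN x + wg x y * NN z) / (NN x * NN y * NN z) := by
    unfold chi; field_simp; ring
  rw [e3, e4]
  gcongr

theorem wg_eq_zero {x y : Sphere} (h : wg x y = 0) : x = y := by
  unfold wg at h
  rw [norm_eq_zero] at h
  induction x using OnePoint.rec with
  | infty =>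
    induction y using OnePoint.rec with
    | infty => rfl
    | coe b => simp at h
  | coe a =>
    induction y using OnePoint.rec with
    | infty => simp at h
    | coe b => simp at h; rw [sub_eq_zero.1 h]

theorem chi_eq_zero {x y : Sphere} (h : chi x y = 0) : x = y := by
  unfold chi at h
  have hx := NN_pos x
  have hy := NN_pos y
  rcases div_eq_zero_iff.1 h with h | h
  · exact wg_eq_zero h
  · exact absurd h (mul_pos hx hy).ne'

theorem chi_le_one (x y : Sphere) : chi x y ≤ 1 := by
  unfold chi
  rw [div_le_one (mul_pos (NN_pos x) (NN_pos y))]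
  unfold wg NN vN
  rw [← Real.sqrt_mul (by positivity)]
  apply Real.le_sqrt_of_sq_le
  set a := hx1 x
  set b := hx2 x
  set c := hx1 y
  set d := hx2 y
  have h1 : ‖a * d - b * c‖ ≤ ‖a‖ * ‖d‖ + ‖b‖ * ‖c‖ := by
    rw [← norm_mul, ← norm_mul]; exact norm_sub_le _ _
  have h0 := norm_nonneg (a * d - b * c)
  nlinarith [sq_nonneg (‖a‖ * ‖c‖ - ‖b‖ * ‖d‖), norm_nonneg a, norm_nonneg b]

theorem chi_nonneg (x y : Sphere) : 0 ≤ chi x y :=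
  div_nonneg (norm_nonneg _) (mul_pos (NN_pos x) (NN_pos y)).le

@[reducible] def preM : MetricSpace Sphere where
  dist := chi
  dist_self := chi_self
  dist_comm := chi_comm
  dist_triangle := chi_tri
  eq_of_dist_eq_zero := chi_eq_zero

theorem chi_nhds (x : Sphere) : Tendsto (fun y => chi x y) (𝓝 x) (𝓝 0) := by
  induction x using OnePoint.rec with
  | infty =>
    rw [OnePoint.tendsto_nhds_infty']
    constructor
    · rw [tendsto_pure_left]
      intro s hs
      rw [chi_self]; exact mem_of_mem_nhds hs
    · have e : ((fun y => chi (OnePoint.infty : Sphere) y) ∘ ((↑) : ℂ → Sphere)) = fun b => (√(1 + ‖b‖ ^ 2))⁻¹ := by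
        funext b
        simp [chi, wg, NN_coe, NN_inf]
      rw [e, Filter.coclosedCompact_eq_cocompact]
      have h1 : Tendsto (fun b : ℂ => ‖b‖) (cocompact ℂ) atTop := tendsto_norm_cocompact_atTop
      refine tendsto_inv_atTop_zero.comp ?_
      refine tendsto_atTop_mono (fun b => ?_) h1
      apply Real.le_sqrt_of_sq_le
      linarith
  | coe a =>
    rw [OnePoint.nhds_coe_eq, tendsto_map'_iff]
    have e : ((fun y => chi (a : Sphere) y) ∘ ((↑) : ℂ → Sphere)) = fun b => dist a b / (√(1 + ‖a‖ ^ 2) * √(1 + ‖b‖ ^ 2)) := by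
      funext b
      simp [chi, wg_coe, NN_coe]
    rw [e]
    have hc : Continuous fun b => dist a b / (√(1 + ‖a‖ ^ 2) * √(1 + ‖b‖ ^ 2)) := by
      refine Continuous.div (by fun_prop) (by fun_prop) fun b => ?_
      have : 0 < √(1 + ‖a‖ ^ 2) := Real.sqrt_pos.2 (by positivity)
      have : 0 < √(1 + ‖b‖ ^ 2) := Real.sqrt_pos.2 (by positivity)
      positivity
    have := hc.tendsto a
    simpa using this

theorem preM_top : (inferInstance : TopologicalSpace Sphere) = preM.toUniformSpace.toTopologicalSpace := by
  have hcont : @Continuous Sphere Sphere inferInstance preM.toUniformSpace.toTopologicalSpace id := by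
    refine (@continuous_iff_continuousAt Sphere Sphere _ preM.toUniformSpace.toTopologicalSpace id).2 ?_
    intro x
    unfold ContinuousAt
    rw [@Metric.tendsto_nhds Sphere Sphere preM.toPseudoMetricSpace]
    intro ε hε
    have := (chi_nhds x).eventually (gt_mem_nhds hε)
    filter_upwards [this] with y hy
    change chi y x < ε
    rw [chi_comm]; exact hy
  refine le_antisymm ?_ ?_
  · exact continuous_id_iff_le.1 hcont
  · rw [TopologicalSpace.le_def]
    intro s hs
    have h1 : IsCompact sᶜ := hs.isClosed_compl.isCompact
    have h2 := @IsCompact.image Sphere Sphere _ preM.toUniformSpace.toTopologicalSpace _ _ h1 hcont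
    rw [Set.image_id] at h2
    have h3 := @IsCompact.isClosed Sphere preM.toUniformSpace.toTopologicalSpace (by
      letI := preM; infer_instance) _ h2
    exact (@isClosed_compl_iff Sphere preM.toUniformSpace.toTopologicalSpace s).1 h3

@[reducible] def sphM : MetricSpace Sphere := preM.replaceTopology preM_top

end Chordal
section ChordalTest
attribute [local instance] sphM
theorem sph_dist (x y : Sphere) : dist x y = chi x y := rfl
theorem sph_inst : (inferInstance : TopologicalSpace (OnePoint ℂ)) = sphM.toUniformSpace.toTopologicalSpace := by
  with_reducible_and_instances rfl
theorem sph_nebot (x : Sphere) : (𝓝[≠] x).NeBot := inferInstance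
end ChordalTest


section RatPF
attribute [local instance] sphM

def ev (d : ℕ) (P : ℂ[X]) (x : Sphere) : ℂ := OnePoint.elim x (P.coeff d) fun a => P.eval a
@[simp] theorem ev_coe (d : ℕ) (P : ℂ[X]) (a : ℂ) : ev d P (a : Sphere) = P.eval a := rfl
@[simp] theorem ev_inf (d : ℕ) (P : ℂ[X]) : ev d P (OnePoint.infty : Sphere) = P.coeff d := rfl

def sph (α β : ℂ) : Sphere := if β = 0 then (OnePoint.infty : Sphere) else ((α / β : ℂ) : Sphere)

theorem chi_sph (α β : ℂ) (h : ¬ (α = 0 ∧ β = 0)) (a : Sphere) :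
    chi (sph α β) a = ‖α * hx2 a - β * hx1 a‖ / (vN α β * NN a) := by
  unfold sph
  split_ifs with hβ
  · subst hβ
    have hα : α ≠ 0 := fun hα => h ⟨hα, rfl⟩
    have : 0 < ‖α‖ := norm_pos_iff.2 hα
    have hv : vN α 0 = ‖α‖ := by simp [vN]
    have := NN_pos a
    rw [hv]
    simp [chi, wg, NN_inf]
    field_simp
  · have hv : vN α β = ‖β‖ * NN ((α / β : ℂ) : Sphere) := by
      unfold NN
      rw [← vN_smul]; simp; congr 1; field_simp
    rw [hv]
    have h1 : α * hx2 a - β * hx1 a = β * ((α/β) * hx2 a - 1 * hx1 a) := by field_simp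
    rw [h1, norm_mul]
    have : 0 < ‖β‖ := norm_pos_iff.2 hβ
    have := NN_pos a
    have := NN_pos ((α / β : ℂ) : Sphere)
    simp only [chi, wg, hx1_coe, hx2_coe]
    field_simp

def SS (P Q : ℂ[X]) (a : Sphere) : ℂ[X] := OnePoint.elim a Q fun b => P - C b * Q

theorem fiber_eq (P Q : ℂ[X]) (a : Sphere) : fiber P Q a = ((SS P Q a).roots.map fun z : ℂ => (z : Sphere)) +
    Multiset.replicate (max P.natDegree Q.natDegree - (SS P Q a).natDegree) (OnePoint.infty : Sphere) := by
  have key : ∀ M : Multiset ℂ, (M.map fun z => (z : Sphere)) = M.map fun z : ℂ => (z : Sphere) := by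
    intro M
    simp [Multiset.bind_singleton]
  induction a using OnePoint.rec with
  | infty => exact congrArg (· + _) (key _)
  | coe b => exact congrArg (· + _) (key _)

theorem sph0 (α : ℂ) : sph α 0 = (OnePoint.infty : Sphere) := if_pos rfl
theorem sph1 (α β : ℂ) (h : β ≠ 0) : sph α β = ((α / β : ℂ) : Sphere) := if_neg h

theorem ratEval_eq (P Q : ℂ[X]) (hd : 1 ≤ max P.natDegree Q.natDegree) (x : Sphere) :
    ratEval P Q x = sph (ev (max P.natDegree Q.natDegree) P x) (ev (max P.natDegree Q.natDegree) Q x) := by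
  induction x using OnePoint.rec with
  | coe a => rfl
  | infty =>
    simp only [ratEval, OnePoint.elim_infty, ev_inf]
    rcases lt_trichotomy Q.natDegree P.natDegree with h | h | h
    · rw [if_pos h, max_eq_left h.le, coeff_eq_zero_of_natDegree_lt h, sph0]
    · have hQ : Q ≠ 0 := by
        rintro rfl
        rw [← h] at hd; simp at hd
      rw [if_neg (by omega), if_neg (by omega), ← h, max_self, sph1]
      · congr 2
        rw [leadingCoeff, h]
      · exact leadingCoeff_ne_zero.2 hQ
    · have hQ : Q ≠ 0 := by
        rintro rfl
        simp at h
      rw [if_neg (by omega), if_pos h, max_eq_right h.le, coeff_eq_zero_of_natDegree_lt h, sph1, zero_div]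
      exact leadingCoeff_ne_zero.2 hQ

theorem ev_SS (P Q : ℂ[X]) (d : ℕ) (x a : Sphere) :
    ‖ev d P x * hx2 a - ev d Q x * hx1 a‖ = ‖ev d (SS P Q a) x‖ := by
  induction x using OnePoint.rec <;> induction a using OnePoint.rec <;> simp [SS, mul_comm]

theorem ev_prod (T : ℂ[X]) (d : ℕ) (hT : T ≠ 0) (hd : T.natDegree ≤ d) (x : Sphere) :
    ‖ev d T x‖ = ‖T.leadingCoeff‖ * (((T.roots.map fun z : ℂ => (z : Sphere)) +
      Multiset.replicate (d - T.natDegree) (OnePoint.infty : Sphere)).map (wg x)).prod := by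
  induction x using OnePoint.rec with
  | coe a =>
    rw [ev_coe, (IsAlgClosed.splits T).eval_eq_prod_roots, norm_mul]
    congr 1
    rw [Multiset.map_add, Multiset.prod_add, Multiset.map_replicate, Multiset.prod_replicate]
    have : wg (a : Sphere) (OnePoint.infty : Sphere) = 1 := by simp [wg]
    rw [this, one_pow, mul_one, Multiset.map_map]
    have h3 : ∀ M : Multiset ℂ, ‖M.prod‖ = (M.map norm).prod := fun M => (map_multiset_prod (normHom : ℂ →*₀ ℝ) M)
    rw [h3, Multiset.map_map]
    simp [Function.comp_def, wg]
  | infty =>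
    rw [ev_inf, Multiset.map_add, Multiset.prod_add, Multiset.map_replicate, Multiset.prod_replicate, Multiset.map_map]
    have h1 : (Multiset.map ((wg (OnePoint.infty : Sphere)) ∘ fun z => ((z : ℂ) : Sphere)) T.roots).prod = 1 := by
      apply Multiset.prod_eq_one
      intro y hy
      obtain ⟨z, _, rfl⟩ := Multiset.mem_map.1 hy
      simp [wg]
    have h2 : wg (OnePoint.infty : Sphere) (OnePoint.infty : Sphere) = 0 := by simp [wg]
    rw [h1, h2, one_mul]
    by_cases h : T.natDegree = d
    · subst h; simp
    · rw [coeff_eq_zero_of_natDegree_lt (by omega), zero_pow (by omega)]; simp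

theorem SS_ne (P Q : ℂ[X]) (hc : IsCoprime P Q) (hd : 1 ≤ max P.natDegree Q.natDegree) (a : Sphere) :
    SS P Q a ≠ 0 := by
  intro h
  induction a using OnePoint.rec with
  | infty =>
    simp only [SS, OnePoint.elim_infty] at h
    subst h
    have := natDegree_eq_zero_of_isUnit (isCoprime_zero_right.1 hc)
    simp [this] at hd
  | coe b =>
    simp only [SS, OnePoint.elim_some] at h
    have hP : P = C b * Q := sub_eq_zero.1 h
    have hu : IsUnit Q := hc.isUnit_of_dvd' ⟨C b, by rw [hP, mul_comm]⟩ dvd_rfl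
    have h1 := natDegree_eq_zero_of_isUnit hu
    have h2 : P.natDegree ≤ Q.natDegree := by rw [hP]; exact natDegree_C_mul_le _ _
    have h3 := max_le h2 le_rfl
    omega

theorem SS_deg (P Q : ℂ[X]) (a : Sphere) : (SS P Q a).natDegree ≤ max P.natDegree Q.natDegree := by
  induction a using OnePoint.rec with
  | infty => exact le_max_right _ _
  | coe b =>
    refine (natDegree_sub_le _ _).trans ?_
    exact max_le_max le_rfl (natDegree_C_mul_le _ _)

theorem ev_ne (P Q : ℂ[X]) (hc : IsCoprime P Q) (hd : 1 ≤ max P.natDegree Q.natDegree) (x : Sphere) :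
    ¬ (ev (max P.natDegree Q.natDegree) P x = 0 ∧ ev (max P.natDegree Q.natDegree) Q x = 0) := by
  rintro ⟨h1, h2⟩
  induction x using OnePoint.rec with
  | coe a =>
    obtain ⟨u, v, huv⟩ := hc
    have := congrArg (Polynomial.eval a) huv
    simp at h1 h2
    simp [h1, h2] at this
  | infty =>
    simp only [ev_inf] at h1 h2
    rcases max_cases P.natDegree Q.natDegree with ⟨h, _⟩ | ⟨h, _⟩
    · rw [h] at h1 hd
      have : P = 0 := leadingCoeff_eq_zero.1 h1
      subst this; simp at hd
    · rw [h] at h2 hd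
      have : Q = 0 := leadingCoeff_eq_zero.1 h2
      subst this; simp at hd

theorem prod_map_mul_const (M : Multiset Sphere) (x : Sphere) :
    (M.map (wg x)).prod = NN x ^ (Multiset.card M) * (M.map NN).prod * (M.map (dist x)).prod := by
  induction M using Multiset.induction_on with
  | empty => simp
  | cons a M ih =>
    simp only [Multiset.map_cons, Multiset.prod_cons, Multiset.card_cons]
    rw [ih, sph_dist]
    have : wg x a = chi x a * (NN x * NN a) := by
      have := NN_pos x
      have := NN_pos a
      unfold chi; field_simp
    rw [this]; ring

theorem rat_PF (P Q : ℂ[X]) (hc : IsCoprime P Q) (hd : 1 ≤ max P.natDegree Q.natDegree) :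
    PF (ratEval P Q) (fiber P Q) (max P.natDegree Q.natDegree) := by
  set d := max P.natDegree Q.natDegree with hdd
  have hcard : ∀ a, Multiset.card (fiber P Q a) = d := by
    intro a
    rw [fiber_eq]
    have := SS_deg P Q a
    simp only [Multiset.card_add, Multiset.card_map, Multiset.card_replicate]
    rw [← (IsAlgClosed.splits (SS P Q a)).natDegree_eq_card_roots]
    omega
  refine ⟨hcard, fun x => NN x ^ d / vN (ev d P x) (ev d Q x),
    fun a => ‖(SS P Q a).leadingCoeff‖ * ((fiber P Q a).map NN).prod / NN a, ?_, ?_, ?_⟩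
  · intro x
    exact div_pos (pow_pos (NN_pos x) _) (vN_pos (ev_ne P Q hc hd x))
  · intro a
    refine div_pos (mul_pos (norm_pos_iff.2 (leadingCoeff_ne_zero.2 (SS_ne P Q hc hd a))) ?_) (NN_pos a)
    refine Multiset.prod_pos ?_
    intro y hy
    obtain ⟨z, _, rfl⟩ := Multiset.mem_map.1 hy
    exact NN_pos z
  · intro x a
    rw [sph_dist, ratEval_eq P Q hd, chi_sph _ _ (ev_ne P Q hc hd x), ev_SS,
      ev_prod _ _ (SS_ne P Q hc hd a) (SS_deg P Q a), ← fiber_eq, prod_map_mul_const, hcard]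
    have := NN_pos a
    have := vN_pos (ev_ne P Q hc hd x)
    simp only [← hdd] at *
    field_simp

def critF (P Q : ℂ[X]) : Finset Sphere :=
  insert (OnePoint.infty : Sphere) ((wronskian P Q).roots.toFinset.image fun z : ℂ => (z : Sphere))

theorem crit_mem (P Q : ℂ[X]) (hc : IsCoprime P Q) (hd : 1 ≤ max P.natDegree Q.natDegree) (a z : Sphere)
    (h : 2 ≤ (fiber P Q a).count z) : z ∈ critF P Q := by
  unfold critF
  rw [Finset.mem_insert]
  induction z using OnePoint.rec with
  | infty => left; rfl
  | coe b =>
    right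
    have hW : wronskian P Q ≠ 0 := by
      intro h0
      obtain ⟨h1, h2⟩ := hc.wronskian_eq_zero_iff.1 h0
      have h1 := natDegree_eq_zero_of_derivative_eq_zero h1
      have h2 := natDegree_eq_zero_of_derivative_eq_zero h2
      simp [h1, h2] at hd
    rw [Finset.mem_image]
    refine ⟨b, ?_, rfl⟩
    rw [Multiset.mem_toFinset, mem_roots hW]
    rw [fiber_eq, Multiset.count_add, Multiset.count_map_eq_count' _ _ OnePoint.coe_injective,
      Multiset.count_replicate, if_neg (OnePoint.infty_ne_coe b), add_zero, count_roots] at h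
    obtain ⟨h3, h4⟩ := (one_lt_rootMultiplicity_iff_isRoot (SS_ne P Q hc hd a)).1 h
    unfold IsRoot at *
    unfold wronskian
    induction a using OnePoint.rec with
    | infty =>
      simp only [SS, OnePoint.elim_infty] at h3 h4
      simp [h3, h4]
    | coe c =>
      simp only [SS, OnePoint.elim_some] at h3 h4
      simp at h3 h4 ⊢
      linear_combination (-Polynomial.eval b (derivative Q)) * (-h3) + Polynomial.eval b Q * (-h4)

end RatPF


section RatDyn
attribute [local instance] sphM

theorem itComp_cons (p q : Fin N → ℂ[X]) (v : Fin N) (w : ℕ → Fin N) (n : ℕ) :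
    itComp p q (consW v w) (n+1) = itComp p q w n ∘ ratEval (p v) (q v) := by
  induction n with
  | zero => simp [itComp, consW]
  | succ n ih =>
    rw [itComp, ih]
    have : consW v w (n+1) = w n := by simp [consW]
    rw [this]; rfl

theorem fatou_fwd (p q : Fin N → ℂ[X]) (v : Fin N) (hR : IsOpenMap (ratEval (p v) (q v))) (w : ℕ → Fin N)
    (y : Sphere) (h : y ∈ fatouW p q (consW v w)) : ratEval (p v) (q v) y ∈ fatouW p q w := by
  obtain ⟨U, hU, hy, hn⟩ := h
  obtain ⟨V, hV, hyV, hVU⟩ := exists_compact_subset hU hy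
  refine ⟨ratEval (p v) (q v) '' interior V, hR _ isOpen_interior, ⟨y, hyV, rfl⟩, ?_⟩
  intro s hs
  choose k hk1 hk using hs
  obtain ⟨φ, hφ, g, hg⟩ := hn (fun n => itComp p q (consW v w) (k n + 1)) (fun n => ⟨k n + 1, by omega, rfl⟩)
  have hex : ∀ ζ, ∃ z, ζ ∈ ratEval (p v) (q v) '' interior V → z ∈ interior V ∧ ratEval (p v) (q v) z = ζ := by
    intro ζ
    by_cases hζ : ζ ∈ ratEval (p v) (q v) '' interior V
    · obtain ⟨z, hz⟩ := hζ; exact ⟨z, fun _ => hz⟩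
    · exact ⟨y, fun h => absurd h hζ⟩
  choose pr hpr using hex
  refine ⟨φ, hφ, fun ζ => g (pr ζ), fun K hK hKc ε hε => ?_⟩
  filter_upwards [hg V hVU hV ε hε] with n hn ζ hζ
  obtain ⟨h1, h2⟩ := hpr ζ (hK hζ)
  have h3 := hn (pr ζ) (interior_subset h1)
  rw [itComp_cons, Function.comp_apply, h2] at h3
  rw [hk]; exact h3

theorem consW_eta (w : ℕ → Fin N) : consW (w 0) (shiftW w) = w := by
  funext n; unfold consW shiftW
  split_ifs with h
  · rw [h]
  · congr 1; omega

theorem julia_back (p q : Fin N → ℂ[X]) (hR : ∀ v, IsOpenMap (ratEval (p v) (q v)))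
    (x : SymX N) (hx : Tmap p q x ∈ juliaSet p q) : x ∈ juliaSet p q := by
  obtain ⟨w, z⟩ := x
  unfold juliaSet at *
  rw [mem_closure_iff] at *
  intro o ho hxo
  obtain ⟨U, V, hU, hV, hwU, hzV, hUV⟩ := isOpen_prod_iff.1 ho w z hxo
  obtain ⟨⟨w', ζ⟩, ⟨h1, h2⟩, h3⟩ := hx ((consW (w 0) ⁻¹' U) ×ˢ (ratEval (p (w 0)) (q (w 0)) '' V))
    ((hU.preimage (consW_continuous _)).prod (hR _ _ hV))
    ⟨by simp only [Tmap, Set.mem_preimage]; rw [consW_eta]; exact hwU, ⟨z, hzV, rfl⟩⟩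
  obtain ⟨y, hy, rfl⟩ := h2
  refine ⟨(consW (w 0) w', y), hUV ⟨h1, hy⟩, ?_⟩
  rw [Set.mem_iUnion] at h3 ⊢
  obtain ⟨w'', h4, h5⟩ := h3
  simp only [Set.mem_singleton_iff] at h4
  subst h4
  refine ⟨consW (w 0) w', rfl, fun hf => h5 (fatou_fwd p q _ (hR _) _ _ hf)⟩

theorem rat_dyn (p q : Fin N → ℂ[X]) (hg : Good p q) (hA1 : NoSuperAttract p q) :
    Dyn (fun v => ratEval (p v) (q v)) (fun v => fiber (p v) (q v)) (degR p q) (juliaSet p q)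
      (Finset.univ.biUnion fun v => critF (p v) (q v)) := by
  obtain ⟨hN, hc, hd, hd2⟩ := hg
  have hpf : ∀ v, PF (ratEval (p v) (q v)) (fiber (p v) (q v)) (degR p q v) := fun v =>
    rat_PF _ _ (hc v) (hd v)
  refine ⟨hpf, hd, ?_, isClosed_closure, ?_, ?_⟩
  · exact julia_back p q fun v => (hpf v).isOpenMap
  · intro v z hz
    rw [Finset.mem_biUnion]
    exact ⟨v, Finset.mem_univ _, crit_mem _ _ (hc v) (hd v) _ _ hz⟩
  · intro x hx m hm hT
    exact hA1 x hx m hm hT 0 (by omega)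

end RatDyn


section CircleNice
attribute [local instance] sphM

def nuC : Measure ℝ := ENNReal.ofReal ((2 * Real.pi)⁻¹) • volume.restrict (Set.Ioc 0 (2 * Real.pi))

theorem nuC_prob : IsProbabilityMeasure nuC := by
  constructor
  have h : (0:ℝ) < 2 * Real.pi := by positivity
  simp only [nuC, Measure.smul_apply, Measure.restrict_apply_univ, Real.volume_Ioc, smul_eq_mul, sub_zero]
  rw [← ENNReal.ofReal_mul (by positivity), inv_mul_cancel₀ h.ne', ENNReal.ofReal_one]

theorem nuC_integral (f : ℝ → ℝ) : ∫ θ, f θ ∂nuC = (2 * Real.pi)⁻¹ * ∫ θ in (0:ℝ)..(2 * Real.pi), f θ := by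
  have h : (0:ℝ) < 2 * Real.pi := by positivity
  rw [nuC, integral_smul_measure, intervalIntegral.integral_of_le h.le, ENNReal.toReal_ofReal (by positivity)]
  rfl

theorem nuC_integrable (f : ℝ → ℝ) (hf : IntervalIntegrable f volume 0 (2 * Real.pi)) : Integrable f nuC := by
  have h : (0:ℝ) < 2 * Real.pi := by positivity
  rw [intervalIntegrable_iff_integrableOn_Ioc_of_le h.le] at hf
  exact Integrable.smul_measure hf ENNReal.ofReal_ne_top

theorem nuC_ac : nuC ≪ volume := by
  refine (Measure.smul_absolutelyContinuous).trans ?_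
  exact Measure.restrict_le_self.absolutelyContinuous

def sf (θ : ℝ) : ℝ := (√|Real.sin θ|)⁻¹

theorem sf_per : Function.Periodic sf (2 * Real.pi) := by
  intro θ; simp [sf]

theorem sf_int (a b : ℝ) : IntervalIntegrable sf volume a b := by
  have hper : Function.Periodic sf Real.pi := by
    intro θ; simp [sf]
  have hmeas : Measurable sf := by
    unfold sf
    fun_prop
  have h1 : IntervalIntegrable sf volume 0 (Real.pi / 2) := by
    have hi : IntervalIntegrable (fun x : ℝ => √(Real.pi / 2) * x ^ (-(1/2) : ℝ)) volume 0 (Real.pi / 2) :=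
      (intervalIntegral.intervalIntegrable_rpow' (by norm_num)).const_mul _
    refine hi.mono_fun' hmeas.aestronglyMeasurable ?_
    rw [Set.uIoc_of_le (by positivity)]
    refine (ae_restrict_iff' measurableSet_Ioc).2 (Eventually.of_forall fun x hx => ?_)
    have h2 := Real.mul_abs_le_abs_sin (x := x) (by rw [abs_of_pos hx.1]; exact hx.2)
    rw [abs_of_pos hx.1] at h2
    have hx0 := hx.1
    have hpi := Real.pi_pos
    show ‖sf x‖ ≤ √(Real.pi / 2) * x ^ (-(1/2) : ℝ)
    rw [Real.norm_of_nonneg (by unfold sf; positivity)]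
    unfold sf
    rw [Real.rpow_neg hx0.le, ← Real.sqrt_eq_rpow]
    calc (√|Real.sin x|)⁻¹ ≤ (√(2 / Real.pi * x))⁻¹ := by
          have : 0 < √(2 / Real.pi * x) := Real.sqrt_pos.2 (by positivity)
          gcongr
      _ = √(Real.pi / 2) * (√x)⁻¹ := by
          rw [Real.sqrt_mul (by positivity), mul_inv, ← Real.sqrt_inv, inv_div]
  have h2 : IntervalIntegrable sf volume (Real.pi / 2) Real.pi := by
    have h3 := h1.comp_sub_left Real.pi
    have e : (fun x => sf (Real.pi - x)) = sf := by
      funext x; simp [sf]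
    rw [e] at h3
    have e2 : Real.pi - Real.pi / 2 = Real.pi / 2 := by ring
    rw [e2, sub_zero] at h3
    exact h3.symm
  have h3 : IntervalIntegrable sf volume 0 (0 + Real.pi) := by
    rw [zero_add]; exact h1.trans h2
  exact hper.intervalIntegrable Real.pi_pos.ne' h3 a b

theorem circ_lower (b y : ℂ) (r θ : ℝ) (hr : 0 < r) :
    r * |Real.sin (θ - Complex.arg (y - b))| ≤ ‖circleMap b r θ - y‖ := by
  set φ := Complex.arg (y - b)
  have h1 : y - b = ‖y - b‖ * Complex.exp (φ * Complex.I) := (Complex.norm_mul_exp_arg_mul_I (y - b)).symm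
  have h2 : (circleMap b r θ - y) * Complex.exp (-φ * Complex.I) = r * Complex.exp ((θ - φ : ℝ) * Complex.I) - ‖y - b‖ := by
    have : circleMap b r θ - y = r * Complex.exp (θ * Complex.I) - (y - b) := by simp [circleMap]; ring
    rw [this]
    nth_rewrite 1 [h1]
    rw [sub_mul, mul_assoc, mul_assoc, ← Complex.exp_add, ← Complex.exp_add]
    have e1 : (θ:ℂ) * Complex.I + -φ * Complex.I = (θ - φ : ℝ) * Complex.I := by push_cast; ring
    have e2 : (φ:ℂ) * Complex.I + -φ * Complex.I = 0 := by ring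
    rw [e1, e2]; simp
  have h3 : ‖circleMap b r θ - y‖ = ‖(circleMap b r θ - y) * Complex.exp (-φ * Complex.I)‖ := by
    rw [norm_mul]
    have : (-(φ:ℂ)) * Complex.I = ((-φ : ℝ) : ℂ) * Complex.I := by push_cast; ring
    rw [this, Complex.norm_exp_ofReal_mul_I, mul_one]
  rw [h3, h2]
  refine le_trans (le_of_eq ?_) (Complex.abs_im_le_norm _)
  rw [Complex.sub_im, Complex.ofReal_im, sub_zero, Complex.im_ofReal_mul, Complex.exp_ofReal_mul_I_im, abs_mul, abs_of_pos hr]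
end CircleNice

section CircleNice2
attribute [local instance] sphM

theorem NN_coe_le (a : ℂ) : NN (a : Sphere) ≤ 1 + ‖a‖ := by
  rw [NN_coe, Real.sqrt_le_left (by positivity)]
  nlinarith [norm_nonneg a]

theorem NN_lip (a y : ℂ) : NN (y : Sphere) ≤ NN (a : Sphere) + ‖a - y‖ := by
  have h := vN_tri 1 (y - a) a 1 1 0
  simp [vN] at h
  rw [NN_coe, NN_coe, norm_sub_rev]
  rw [add_comm 1, add_comm 1]
  exact h

theorem chi_sqrt_bound (a : ℂ) (y : ℂ) (M s : ℝ) (hM1 : 1 ≤ M) (hM : NN (a : Sphere) ≤ M) (hs : 0 < s)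
    (hsd : s ≤ ‖a - y‖) : (√(chi (a : Sphere) y))⁻¹ ≤ M * (1 + (√s)⁻¹) := by
  have hd : 0 < ‖a - y‖ := hs.trans_le hsd
  have hNa := NN_pos (a : Sphere)
  have hNy := NN_pos (y : Sphere)
  have e : chi (a : Sphere) y = ‖a - y‖ / (NN (a : Sphere) * NN (y : Sphere)) := by
    rw [chi, wg_coe, dist_eq_norm]
  rw [← Real.sqrt_inv, e, inv_div]
  have h1 : NN (a : Sphere) * NN (y : Sphere) / ‖a - y‖ ≤ M ^ 2 * (1 + s⁻¹) := by
    calc NN (a : Sphere) * NN (y : Sphere) / ‖a - y‖ ≤ M * (M + ‖a - y‖) / ‖a - y‖ := by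
          gcongr
          exact (NN_lip a y).trans (by linarith)
      _ = M ^ 2 * ‖a - y‖⁻¹ + M := by field_simp
      _ ≤ M ^ 2 * s⁻¹ + M ^ 2 := by
          gcongr
          nlinarith
      _ = _ := by ring
  calc _ ≤ √(M ^ 2 * (1 + s⁻¹)) := Real.sqrt_le_sqrt h1
    _ = M * √(1 + s⁻¹) := by rw [Real.sqrt_mul (by positivity), Real.sqrt_sq (by linarith)]
    _ ≤ M * (1 + (√s)⁻¹) := by
        gcongr
        rw [← Real.sqrt_inv, Real.sqrt_le_left (by positivity)]
        have : √s⁻¹ ^ 2 = s⁻¹ := Real.sq_sqrt (by positivity)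
        nlinarith [Real.sqrt_nonneg s⁻¹]

theorem coe_circle_cont (b : ℂ) (r : ℝ) : Continuous fun θ : ℝ => ((circleMap b r θ : ℂ) : Sphere) :=
  OnePoint.continuous_coe.comp (continuous_circleMap b r)

theorem circle_bound (R0 r0 : ℝ) (hR0 : 0 ≤ R0) (hr0 : 0 < r0) (b : ℂ) (hb : ‖b‖ ≤ R0) (r : ℝ)
    (h1 : r0 / 2 ≤ r) (h2 : r ≤ r0) (y : Sphere) : ∃ φ : ℝ, ∀ᵐ θ ∂nuC,
      (√(dist ((circleMap b r θ : ℂ) : Sphere) y))⁻¹ ≤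
        (1 + R0 + r0) * (1 + (√(r0 / 2))⁻¹ * sf (θ - φ)) := by
  have hr : 0 < r := by linarith
  have hM : ∀ θ, NN ((circleMap b r θ : ℂ) : Sphere) ≤ 1 + R0 + r0 := by
    intro θ
    refine (NN_coe_le _).trans ?_
    have : ‖circleMap b r θ‖ ≤ ‖b‖ + r := by
      have := norm_circleMap_zero r θ
      rw [abs_of_pos hr] at this
      have e : circleMap b r θ = b + circleMap 0 r θ := by simp [circleMap]
      rw [e]
      exact (norm_add_le b (circleMap 0 r θ)).trans (by rw [this])
    linarith
  induction y using OnePoint.rec with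
  | infty =>
    refine ⟨0, Eventually.of_forall fun θ => ?_⟩
    have e : dist ((circleMap b r θ : ℂ) : Sphere) OnePoint.infty = (NN ((circleMap b r θ : ℂ) : Sphere))⁻¹ := by
      rw [sph_dist, chi, NN_inf]; simp [wg]
    rw [e, ← Real.sqrt_inv, inv_inv]
    have hsf : 0 ≤ sf (θ - 0) := by unfold sf; positivity
    calc √(NN ((circleMap b r θ : ℂ) : Sphere)) ≤ √((1 + R0 + r0) ^ 2) := by
          apply Real.sqrt_le_sqrt
          have := hM θ
          nlinarith
      _ = 1 + R0 + r0 := Real.sqrt_sq (by linarith)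
      _ ≤ _ := by
        apply le_mul_of_one_le_right (by linarith)
        have : 0 ≤ (√(r0 / 2))⁻¹ * sf (θ - 0) := by positivity
        linarith
  | coe y =>
    refine ⟨Complex.arg (y - b), ?_⟩
    apply nuC_ac.ae_le
    have hc : {θ : ℝ | Real.sin (θ - Complex.arg (y - b)) = 0}.Countable := by
      refine (Set.countable_range fun n : ℤ => (n : ℝ) * Real.pi + Complex.arg (y - b)).mono ?_
      intro θ hθ
      obtain ⟨n, hn⟩ := Real.sin_eq_zero_iff.1 hθ
      exact ⟨n, by simp only [hn]; ring⟩
    filter_upwards [hc.ae_notMem volume] with θ hθ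
    have hsin : 0 < |Real.sin (θ - Complex.arg (y - b))| := abs_pos.2 hθ
    rw [sph_dist]
    have h3 := chi_sqrt_bound (circleMap b r θ) y (1 + R0 + r0) (r0 / 2 * |Real.sin (θ - Complex.arg (y - b))|)
      (by linarith) (hM θ) (by positivity) (le_trans (by gcongr) (circ_lower b y r θ hr))
    rw [Real.sqrt_mul (by positivity), mul_inv] at h3
    exact h3

theorem circle_nice (R0 r0 : ℝ) (hR0 : 0 ≤ R0) (hr0 : 0 < r0) : ∃ C : ℝ, ∀ b : ℂ, ‖b‖ ≤ R0 → ∀ r : ℝ,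
    r0 / 2 ≤ r → r ≤ r0 → Nice nuC (fun θ : ℝ => ((circleMap b r θ : ℂ) : Sphere)) C := by
  refine ⟨(1 + R0 + r0) * (1 + (√(r0 / 2))⁻¹ * ((2 * Real.pi)⁻¹ * ∫ θ in (0:ℝ)..(2 * Real.pi), sf θ)), ?_⟩
  intro b hb r h1 h2
  have hr : 0 < r := by linarith
  haveI := nuC_prob
  have hsfi : ∀ φ, Integrable (fun θ => sf (θ - φ)) nuC := by
    intro φ
    apply nuC_integrable
    have := (sf_int (0 - φ) (2 * Real.pi - φ)).comp_sub_right φ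
    simpa using this
  have hsfe : ∀ φ, ∫ θ, sf (θ - φ) ∂nuC = (2 * Real.pi)⁻¹ * ∫ θ in (0:ℝ)..(2 * Real.pi), sf θ := by
    intro φ
    rw [nuC_integral, intervalIntegral.integral_comp_sub_right sf φ]
    have := sf_per.intervalIntegral_add_eq (0 - φ) 0
    rw [zero_add] at this
    rw [← this]; congr 2; ring
  have hcont := coe_circle_cont b r
  have hbi : ∀ φ, Integrable (fun θ => (1 + R0 + r0) * (1 + (√(r0 / 2))⁻¹ * sf (θ - φ))) nuC := by
    intro φ
    exact (((integrable_const (1:ℝ)).add ((hsfi φ).const_mul _)).const_mul _)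
  have hint : ∀ y : Sphere, Integrable (fun θ => (√(dist ((circleMap b r θ : ℂ) : Sphere) y))⁻¹) nuC := by
    intro y
    obtain ⟨φ, hφ⟩ := circle_bound R0 r0 hR0 hr0 b hb r h1 h2 y
    refine (hbi φ).mono' ?_ ?_
    · have : Continuous fun θ : ℝ => dist ((circleMap b r θ : ℂ) : Sphere) y := hcont.dist continuous_const
      exact (this.measurable.sqrt.inv).aestronglyMeasurable
    · filter_upwards [hφ] with θ hθ
      rw [Real.norm_of_nonneg (by positivity)]
      exact hθ
  refine ⟨nuC_prob, hcont, ?_, hint, ?_⟩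
  · intro y
    induction y using OnePoint.rec with
    | infty => exact Eventually.of_forall fun θ => OnePoint.coe_ne_infty _
    | coe y =>
      apply nuC_ac.ae_le
      filter_upwards [((Set.countable_singleton y).preimage_circleMap b hr.ne').ae_notMem volume] with θ hθ h
      exact hθ (OnePoint.coe_injective h)
  · intro y
    obtain ⟨φ, hφ⟩ := circle_bound R0 r0 hR0 hr0 b hb r h1 h2 y
    refine (integral_mono_ae (hint y) (hbi φ) hφ).trans (le_of_eq ?_)
    rw [integral_const_mul, integral_add (integrable_const _) ((hsfi φ).const_mul _), integral_const_mul, hsfe]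
    simp

def ub (r t : ℝ) : ℝ := Real.log 2 + Real.posLog (r⁻¹ * t) - Real.posLog ((r / 2)⁻¹ * t)

def cst (b : ℂ) (r : ℝ) : ℝ := ∫ θ, Real.log (NN ((circleMap b r θ : ℂ) : Sphere)) ∂nuC

theorem NN_coe_cont : Continuous fun a : ℂ => NN (a : Sphere) := by
  have : (fun a : ℂ => NN (a : Sphere)) = fun a : ℂ => √(1 + ‖a‖ ^ 2) := funext NN_coe
  rw [this]; fun_prop

theorem cst_int (b : ℂ) (r : ℝ) : Integrable (fun θ => Real.log (NN ((circleMap b r θ : ℂ) : Sphere))) nuC := by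
  apply nuC_integrable
  apply Continuous.intervalIntegrable
  exact (NN_coe_cont.comp (continuous_circleMap b r)).log fun θ => (NN_pos _).ne'

theorem pot_inf (b : ℂ) (r : ℝ) :
    ∫ θ, Real.log (dist ((circleMap b r θ : ℂ) : Sphere) OnePoint.infty) ∂nuC = - cst b r := by
  rw [cst, ← integral_neg]
  congr 1; funext θ
  rw [sph_dist, chi, NN_inf]; simp [wg]

theorem pot_coe (b : ℂ) (r : ℝ) (hr : 0 < r) (y : ℂ) :
    ∫ θ, Real.log (dist ((circleMap b r θ : ℂ) : Sphere) y) ∂nuC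
      = Real.log r + Real.posLog (r⁻¹ * ‖b - y‖) - cst b r - Real.log (NN (y : Sphere)) := by
  haveI := nuC_prob
  have hi : Integrable (fun θ => Real.log ‖circleMap b r θ - y‖) nuC := by
    apply nuC_integrable
    exact circleIntegrable_log_norm_sub_const (a := y) (c := b) r
  have e : ∫ θ, Real.log ‖circleMap b r θ - y‖ ∂nuC = Real.log r + Real.posLog (r⁻¹ * ‖b - y‖) := by
    rw [nuC_integral, ← circleAverage_log_norm_sub_const_eq_log_radius_add_posLog hr.ne', Real.circleAverage]
    rfl
  have hae : (fun θ => Real.log (dist ((circleMap b r θ : ℂ) : Sphere) y)) =ᵐ[nuC]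
     fun θ => Real.log ‖circleMap b r θ - y‖ - Real.log (NN ((circleMap b r θ : ℂ) : Sphere)) - Real.log (NN (y : Sphere)) := by
    apply nuC_ac.ae_le
    filter_upwards [((Set.countable_singleton y).preimage_circleMap b hr.ne').ae_notMem volume] with θ hθ
    have : ‖circleMap b r θ - y‖ ≠ 0 := fun h => hθ (sub_eq_zero.1 (norm_eq_zero.1 h))
    rw [sph_dist, chi, wg_coe, dist_eq_norm, Real.log_div this (mul_pos (NN_pos _) (NN_pos _)).ne',
      Real.log_mul (NN_pos _).ne' (NN_pos _).ne']
    ring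
  rw [integral_congr_ae hae, integral_sub (f := fun θ => Real.log ‖circleMap b r θ - y‖ - Real.log (NN ((circleMap b r θ : ℂ) : Sphere))) (hi.sub (cst_int b r)) (integrable_const _), integral_sub hi (cst_int b r), e, cst]
  simp

def beta (r : ℝ) (b : ℂ) (y : Sphere) : ℝ := OnePoint.elim y 0 fun a => ub r ‖b - a‖

theorem pot_diff (b : ℂ) (r : ℝ) (hr : 0 < r) (y : Sphere) :
    (∫ θ, Real.log (dist ((circleMap b r θ : ℂ) : Sphere) y) ∂nuC)
      - ∫ θ, Real.log (dist ((circleMap b (r/2) θ : ℂ) : Sphere) y) ∂nuC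
    = beta r b y + (cst b (r/2) - cst b r) := by
  induction y using OnePoint.rec with
  | infty =>
    rw [pot_inf, pot_inf]; simp [beta]; ring
  | coe y =>
    rw [pot_coe b r hr, pot_coe b (r/2) (by positivity)]
    show _ = ub r ‖b - y‖ + _
    rw [ub, Real.log_div hr.ne' (by norm_num)]; ring

theorem ub_zero (r t : ℝ) (hr : 0 < r) (ht : r ≤ t) : ub r t = 0 := by
  unfold ub
  have h0 : 0 < t := hr.trans_le ht
  have h1 : 1 ≤ r⁻¹ * t := by rw [inv_mul_eq_div]; exact (one_le_div hr).2 ht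
  have e : (r / 2)⁻¹ * t = 2 * (r⁻¹ * t) := by field_simp
  rw [e, Real.posLog_eq_log (by rw [abs_of_pos (by positivity)]; exact h1),
    Real.posLog_eq_log (by rw [abs_of_pos (by positivity)]; linarith), Real.log_mul (by norm_num) (x := 2) (y := r⁻¹ * t) (by positivity)]
  ring

theorem ub_in (r t : ℝ) (hr : 0 < r) (h0 : 0 ≤ t) (ht : t ≤ r / 2) : ub r t = Real.log 2 := by
  unfold ub
  have h1 : (r / 2)⁻¹ * t ≤ 1 := by rw [inv_mul_eq_div]; exact (div_le_one (by positivity)).2 ht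
  have e : (r / 2)⁻¹ * t = 2 * (r⁻¹ * t) := by field_simp
  have h3 : 0 ≤ r⁻¹ * t := by positivity
  rw [(Real.posLog_eq_zero_iff _).2 (by rw [abs_of_nonneg h3]; linarith), (Real.posLog_eq_zero_iff _).2 (by rw [abs_of_nonneg (by positivity)]; linarith)]
  ring

theorem ub_nonneg (r t : ℝ) (hr : 0 < r) (h0 : 0 ≤ t) : 0 ≤ ub r t := by
  rcases le_total t (r / 2) with h | h
  · rw [ub_in r t hr h0 h]; positivity
  · unfold ub
    have ht : 0 < t := by linarith [half_pos hr]
    have h1 : 1 ≤ (r / 2)⁻¹ * t := by rw [inv_mul_eq_div]; exact (one_le_div (by positivity)).2 h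
    have e : (r / 2)⁻¹ * t = 2 * (r⁻¹ * t) := by field_simp
    have h2 : 0 < r⁻¹ * t := by positivity
    rw [Real.posLog_eq_log (x := (r / 2)⁻¹ * t) (by rw [abs_of_pos (by positivity)]; exact h1), e, Real.log_mul (by norm_num) h2.ne']
    have : Real.log (r⁻¹ * t) ≤ Real.posLog (r⁻¹ * t) := le_max_right _ _
    linarith

theorem ub_cont (r : ℝ) : Continuous (ub r) := by
  unfold ub
  have := Real.continuous_posLog
  fun_prop
end CircleNice2

section ClassCl

theorem msum_close {α : Type*} (M : Multiset α) (f g : α → ℝ) (δ : ℝ) (h : ∀ y ∈ M, |f y - g y| ≤ δ) :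
    |(M.map f).sum - (M.map g).sum| ≤ Multiset.card M * δ := by
  induction M using Multiset.induction with
  | empty => simp
  | cons a s ih =>
    have h1 := ih fun y hy => h y (Multiset.mem_cons_of_mem hy)
    have h2 := h a (Multiset.mem_cons_self a s)
    simp only [Multiset.map_cons, Multiset.sum_cons, Multiset.card_cons]
    push_cast
    rw [abs_le] at *
    constructor <;> linarith [h1.1, h1.2, h2.1, h2.2]

attribute [local instance] sphM

variable {R : Fin N → Sphere → Sphere} {fib : Fin N → Sphere → Multiset Sphere} {d : Fin N → ℕ}
    {J : Set ((ℕ → Fin N) × Sphere)} {Fc : Finset Sphere}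

def SumW (fib : Fin N → Sphere → Multiset Sphere) (l : List (Fin N)) (g : Sphere → ℝ) (z : Sphere) : ℝ :=
  ((fibW fib l z).map g).sum

def Cl (fib : Fin N → Sphere → Multiset Sphere) (d : Fin N → ℕ) (J : Set ((ℕ → Fin N) × Sphere)) (ρ : ℝ)
    (g : Sphere → ℝ) : Prop :=
  ∀ ε > 0, ∃ m0 : ℕ, ∀ l : List (Fin N), m0 ≤ l.length → ∀ x ∈ J, ∀ x' ∈ J,
    |SumW fib l g x.2 - SumW fib l g x'.2| ≤ ε * (ρ ^ l.length + dW d l)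

theorem SumW_close (H : Dyn R fib d J Fc) (l : List (Fin N)) (f g : Sphere → ℝ) (δ : ℝ)
    (h : ∀ y, |f y - g y| ≤ δ) (z : Sphere) : |SumW fib l f z - SumW fib l g z| ≤ dW d l * δ := by
  have h1 := msum_close (fibW fib l z) f g δ fun y _ => h y
  rw [(PF.word H.pf l).card] at h1
  exact h1

theorem SumW_add_const (H : Dyn R fib d J Fc) (l : List (Fin N)) (f : Sphere → ℝ) (c : ℝ) (z : Sphere) :
    SumW fib l (fun y => f y + c) z = SumW fib l f z + dW d l * c := by
  unfold SumW
  rw [Multiset.sum_map_add, Multiset.map_const', Multiset.sum_replicate, (PF.word H.pf l).card, nsmul_eq_mul]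

theorem SumW_mul_const (l : List (Fin N)) (f : Sphere → ℝ) (c : ℝ) (z : Sphere) :
    SumW fib l (fun y => c * f y) z = c * SumW fib l f z := by
  unfold SumW
  rw [Multiset.sum_map_mul_left]

theorem cl_add_const (H : Dyn R fib d J Fc) {ρ : ℝ} {g : Sphere → ℝ} (hg : Cl fib d J ρ g) (c : ℝ) :
    Cl fib d J ρ (fun y => g y + c) := by
  intro ε hε
  obtain ⟨m0, hm⟩ := hg ε hε
  refine ⟨m0, fun l hl x hx x' hx' => ?_⟩
  rw [SumW_add_const H, SumW_add_const H, add_sub_add_right_eq_sub]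
  exact hm l hl x hx x' hx'

theorem cl_mul {ρ : ℝ} (hρ : 0 < ρ) {g : Sphere → ℝ} (hg : Cl fib d J ρ g) (c : ℝ) :
    Cl fib d J ρ (fun y => c * g y) := by
  intro ε hε
  obtain ⟨m0, hm⟩ := hg (ε / (|c| + 1)) (by positivity)
  refine ⟨m0, fun l hl x hx x' hx' => ?_⟩
  rw [SumW_mul_const, SumW_mul_const, ← mul_sub, abs_mul]
  have h := hm l hl x hx x' hx'
  have hp : 0 ≤ ρ ^ l.length + (dW d l : ℝ) := by positivity
  calc |c| * |SumW fib l g x.2 - SumW fib l g x'.2| ≤ (|c| + 1) * (ε / (|c| + 1) * (ρ ^ l.length + dW d l)) := by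
        gcongr; linarith
    _ = _ := by field_simp

theorem cl_approx (H : Dyn R fib d J Fc) {ρ : ℝ} (hρ : 0 < ρ) {g : Sphere → ℝ}
    (h : ∀ δ > 0, ∃ g', Cl fib d J ρ g' ∧ ∀ y, |g y - g' y| ≤ δ) : Cl fib d J ρ g := by
  intro ε hε
  obtain ⟨g', hg', hc⟩ := h (ε / 3) (by positivity)
  obtain ⟨m0, hm⟩ := hg' (ε / 3) (by positivity)
  refine ⟨m0, fun l hl x hx x' hx' => ?_⟩
  have h1 := hm l hl x hx x' hx'
  have h2 := SumW_close H l g g' _ hc x.2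
  have h3 := SumW_close H l g g' _ hc x'.2
  have hp : 0 ≤ ρ ^ l.length := by positivity
  have hp2 : ε / 3 * (ρ ^ l.length + (dW d l : ℝ)) + (dW d l : ℝ) * (ε / 3) + (dW d l : ℝ) * (ε / 3)
     ≤ ε * (ρ ^ l.length + dW d l) := by
    have : 0 ≤ ε * ρ ^ l.length := by positivity
    linarith
  rw [abs_le] at *
  constructor <;> linarith [h1.1, h1.2, h2.1, h2.2, h3.1, h3.2]

theorem beta_uniform (H : Dyn R fib d J Fc) (ρ : ℝ) (hρ : 1 < ρ) (R0 r : ℝ) (hR0 : 0 ≤ R0) (hr : 0 < r)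
    (ε : ℝ) (hε : 0 < ε) : ∃ m0 : ℕ, ∀ l : List (Fin N), m0 ≤ l.length → ∀ x ∈ J, ∀ x' ∈ J, ∀ b : ℂ, ‖b‖ ≤ R0 →
    |SumW fib l (beta r b) x.2 - SumW fib l (beta r b) x'.2| ≤ ε * ρ ^ l.length := by
  obtain ⟨C, hC⟩ := circle_nice R0 r hR0 hr
  haveI : ∀ x : Sphere, (𝓝[≠] x).NeBot := sph_nebot
  obtain ⟨m0, hm⟩ := Dyn.main H chi_le_one OnePoint.infty ρ hρ C ε hε
  refine ⟨m0, fun l hl x hx x' hx' b hb => ?_⟩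
  have h := hm l hl x hx x' hx' nuC _ nuC _ (hC b hb r (by linarith) le_rfl) (hC b hb (r/2) le_rfl (by linarith))
  simp only [pot_diff b r hr] at h
  have e := SumW_add_const H l (beta r b) (cst b (r/2) - cst b r)
  unfold SumW at e
  rw [e, e, add_sub_add_right_eq_sub] at h
  exact h

theorem beta_cont (r : ℝ) (y : Sphere) : Continuous fun b : ℂ => beta r b y := by
  induction y using OnePoint.rec with
  | infty => exact continuous_const
  | coe y =>
    show Continuous fun b : ℂ => ub r ‖b - y‖
    exact (ub_cont r).comp (by fun_prop)

def FF (f : ℂ → ℝ) (r : ℝ) (y : Sphere) : ℝ := ∫ b : ℂ, f b * beta r b y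

theorem FF_int (f : ℂ → ℝ) (hf : Continuous f) (hfc : HasCompactSupport f) (r : ℝ) (y : Sphere) :
    Integrable (fun b : ℂ => f b * beta r b y) :=
  (hf.mul (beta_cont r y)).integrable_of_hasCompactSupport hfc.mul_right

theorem SumW_FF_aux (M : Multiset Sphere) (f : ℂ → ℝ) (hf : Continuous f) (hfc : HasCompactSupport f) (r : ℝ) :
    Integrable (fun b : ℂ => f b * (M.map (beta r b)).sum) ∧
    (M.map (FF f r)).sum = ∫ b : ℂ, f b * (M.map (beta r b)).sum := by
  induction M using Multiset.induction with
  | empty => simp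
  | cons a s ih =>
    simp only [Multiset.map_cons, Multiset.sum_cons, mul_add]
    refine ⟨(FF_int f hf hfc r a).add ih.1, ?_⟩
    rw [integral_add (FF_int f hf hfc r a) ih.1, ih.2]; rfl

theorem cl_FF (H : Dyn R fib d J Fc) (ρ : ℝ) (hρ : 1 < ρ) (f : ℂ → ℝ) (hf : Continuous f)
    (hfc : HasCompactSupport f) (r : ℝ) (hr : 0 < r) : Cl fib d J ρ (FF f r) := by
  intro ε hε
  obtain ⟨R0, hR0, hsup⟩ : ∃ R0, 0 ≤ R0 ∧ ∀ b : ℂ, R0 < ‖b‖ → f b = 0 := by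
    obtain ⟨R0, h⟩ := hfc.isCompact.isBounded.exists_norm_le
    refine ⟨max R0 0, le_max_right _ _, fun b hb => ?_⟩
    by_contra hne
    have := h b (subset_tsupport f hne)
    exact absurd (lt_of_le_of_lt (le_max_left R0 0) hb) (not_lt.2 this)
  set A : ℝ := ∫ b : ℂ, |f b| with hA
  have hA0 : 0 ≤ A := integral_nonneg fun b => abs_nonneg _
  have hfi : Integrable fun b : ℂ => |f b| :=
    (hf.abs).integrable_of_hasCompactSupport (by simpa using hfc.norm)
  obtain ⟨m0, hm⟩ := beta_uniform H ρ hρ R0 r hR0 hr (ε / (A + 1)) (by positivity)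
  refine ⟨m0, fun l hl x hx x' hx' => ?_⟩
  have e1 := SumW_FF_aux (fibW fib l x.2) f hf hfc r
  have e2 := SumW_FF_aux (fibW fib l x'.2) f hf hfc r
  unfold SumW
  rw [e1.2, e2.2, ← integral_sub e1.1 e2.1]
  have hρp : 0 < ρ ^ l.length := by positivity
  calc |∫ b : ℂ, (f b * ((fibW fib l x.2).map (beta r b)).sum - f b * ((fibW fib l x'.2).map (beta r b)).sum)|
      ≤ ∫ b : ℂ, |f b * ((fibW fib l x.2).map (beta r b)).sum - f b * ((fibW fib l x'.2).map (beta r b)).sum| :=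
        abs_integral_le_integral_abs
    _ ≤ ∫ b : ℂ, |f b| * (ε / (A + 1) * ρ ^ l.length) := by
        refine integral_mono (e1.1.sub e2.1).abs (hfi.mul_const _) fun b => ?_
        show |f b * ((fibW fib l x.2).map (beta r b)).sum - f b * ((fibW fib l x'.2).map (beta r b)).sum| ≤ _
        rw [← mul_sub, abs_mul]
        by_cases hb : ‖b‖ ≤ R0
        · exact mul_le_mul_of_nonneg_left (hm l hl x hx x' hx' b hb) (abs_nonneg _)
        · rw [hsup b (not_le.1 hb)]; simp
    _ = A / (A + 1) * (ε * ρ ^ l.length) := by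
        rw [integral_mul_const, ← hA]; ring
    _ ≤ 1 * (ε * ρ ^ l.length) := by
        gcongr
        rw [div_le_one (by positivity)]; linarith
    _ ≤ ε * (ρ ^ l.length + dW d l) := by
        have : 0 ≤ ε * (dW d l : ℝ) := by positivity
        linarith

def extz (f : ℂ → ℝ) (y : Sphere) : ℝ := OnePoint.elim y 0 f

theorem cl_extz (H : Dyn R fib d J Fc) (ρ : ℝ) (hρ : 1 < ρ) (f : ℂ → ℝ) (hf : Continuous f)
    (hfc : HasCompactSupport f) : Cl fib d J ρ (extz f) := by
  apply cl_approx H (by linarith)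
  intro δ hδ
  obtain ⟨r', hr', huc⟩ := Metric.uniformContinuous_iff.1 (hfc.uniformContinuous_of_continuous hf) δ hδ
  set r := r' / 2 with hrdef
  have hr : 0 < r := by positivity
  have hubc : Continuous fun b : ℂ => ub r ‖b‖ := (ub_cont r).comp continuous_norm
  have hubs : HasCompactSupport fun b : ℂ => ub r ‖b‖ := by
    refine HasCompactSupport.intro (isCompact_closedBall (0:ℂ) r) fun b hb => ?_
    apply ub_zero r _ hr
    simp at hb; exact hb.le
  have hubi : Integrable fun b : ℂ => ub r ‖b‖ := hubc.integrable_of_hasCompactSupport hubs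
  set c : ℝ := ∫ b : ℂ, ub r ‖b‖ with hc
  have hcpos : 0 < c := by
    refine hubc.integral_pos_of_hasCompactSupport_nonneg_nonzero hubs (fun b => ub_nonneg r _ hr (norm_nonneg _)) (x := 0) ?_
    rw [norm_zero, ub_in r 0 hr le_rfl (by positivity)]
    exact (Real.log_pos (by norm_num)).ne'
  refine ⟨fun y => c⁻¹ * FF f r y, cl_mul (by linarith) (cl_FF H ρ hρ f hf hfc r hr) _, fun y => ?_⟩
  induction y using OnePoint.rec with
  | infty => simp [extz, FF, beta]; exact hδ.le
  | coe y =>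
    show |f y - c⁻¹ * ∫ b : ℂ, f b * ub r ‖b - y‖| ≤ δ
    have hi : Integrable fun b : ℂ => ub r ‖b - y‖ := hubi.comp_sub_right y
    have he : ∫ b : ℂ, ub r ‖b - y‖ = c := integral_sub_right_eq_self (fun b : ℂ => ub r ‖b‖) y
    have hfi : Integrable fun b : ℂ => f b * ub r ‖b - y‖ := FF_int f hf hfc r y
    have key : |∫ b : ℂ, (f y * ub r ‖b - y‖ - f b * ub r ‖b - y‖)| ≤ δ * c := by
      rw [← he, ← integral_const_mul]
      refine abs_integral_le_integral_abs.trans ?_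
      refine integral_mono ((hi.const_mul _).sub hfi).abs (hi.const_mul _) fun b => ?_
      show |f y * ub r ‖b - y‖ - f b * ub r ‖b - y‖| ≤ δ * ub r ‖b - y‖
      have hn := ub_nonneg r ‖b - y‖ hr (norm_nonneg _)
      rw [← sub_mul, abs_mul, abs_of_nonneg hn]
      by_cases hb : ‖b - y‖ ≤ r
      · apply mul_le_mul_of_nonneg_right _ hn
        have := huc (a := y) (b := b) (by rw [dist_eq_norm, norm_sub_rev]; linarith)
        exact (le_of_lt this)
      · rw [ub_zero r _ hr (not_le.1 hb).le]; simp
    rw [integral_sub (hi.const_mul _) hfi, integral_const_mul, he] at key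
    have : f y - c⁻¹ * ∫ b : ℂ, f b * ub r ‖b - y‖ = c⁻¹ * (f y * c - ∫ b : ℂ, f b * ub r ‖b - y‖) := by
      field_simp
    rw [this, abs_mul, abs_of_pos (inv_pos.2 hcpos), inv_mul_le_iff₀ hcpos]
    linarith

theorem cl_cont (H : Dyn R fib d J Fc) (ρ : ℝ) (hρ : 1 < ρ) (f : Sphere → ℝ) (hf : Continuous f) :
    Cl fib d J ρ f := by
  apply cl_approx H (by linarith)
  intro δ hδ
  set c := f OnePoint.infty with hc
  set g : ℂ → ℝ := fun a => (f a - c) - max (-δ) (min (f a - c) δ) with hg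
  have hfc : Continuous fun a : ℂ => f a := hf.comp OnePoint.continuous_coe
  have hgc : Continuous g := by
    have h1 : Continuous fun a : ℂ => f a - c := hfc.sub continuous_const
    exact h1.sub (continuous_const.max (h1.min continuous_const))
  have hgs : HasCompactSupport g := by
    have ht : Tendsto (fun a : ℂ => f a) (coclosedCompact ℂ) (𝓝 c) :=
      (hf.tendsto OnePoint.infty).comp OnePoint.tendsto_coe_infty
    rw [coclosedCompact_eq_cocompact] at ht
    have hev := ht (Metric.ball_mem_nhds c hδ)
    obtain ⟨K, hK, hsub⟩ := mem_cocompact.1 hev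
    refine HasCompactSupport.intro hK fun a ha => ?_
    have h2 : dist (f a) c < δ := hsub ha
    rw [Real.dist_eq, abs_lt] at h2
    simp only [hg]
    rw [min_eq_left h2.2.le, max_eq_right h2.1.le, sub_self]
  refine ⟨fun y => extz g y + c, cl_add_const H (cl_extz H ρ hρ g hgc hgs) c, fun y => ?_⟩
  induction y using OnePoint.rec with
  | infty => simp [extz, hc]; exact hδ.le
  | coe a =>
    show |f a - (((f a - c) - max (-δ) (min (f a - c) δ)) + c)| ≤ δ
    have : f a - (((f a - c) - max (-δ) (min (f a - c) δ)) + c) = max (-δ) (min (f a - c) δ) := by ring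
    rw [this, abs_le]
    exact ⟨le_max_left _ _, max_le (by linarith) (min_le_right _ _)⟩
end ClassCl

section Assembly

def WS : ℕ → (List (Fin N) → ℝ) → ℝ
  | 0, Φ => Φ []
  | m + 1, Φ => ∑ v, WS m fun l => Φ (v :: l)

theorem WS_close (m : ℕ) (Φ Ψ Θ : List (Fin N) → ℝ) (h : ∀ l : List (Fin N), l.length = m → |Φ l - Ψ l| ≤ Θ l) :
    |WS m Φ - WS m Ψ| ≤ WS m Θ := by
  induction m generalizing Φ Ψ Θ with
  | zero => exact h [] rfl
  | succ m ih =>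
    simp only [WS]
    rw [← Finset.sum_sub_distrib]
    refine (Finset.abs_sum_le_sum_abs _ _).trans (Finset.sum_le_sum fun v _ => ?_)
    exact ih _ _ _ fun l hl => h (v :: l) (by simp [hl])

theorem WS_const (m : ℕ) (c : ℝ) : WS m (fun _ : List (Fin N) => c) = (N : ℝ) ^ m * c := by
  induction m with
  | zero => simp [WS]
  | succ m ih => simp only [WS, ih]; simp [pow_succ]; ring

theorem WS_add (m : ℕ) (Φ Ψ : List (Fin N) → ℝ) : WS m (fun l => Φ l + Ψ l) = WS m Φ + WS m Ψ := by
  induction m generalizing Φ Ψ with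
  | zero => rfl
  | succ m ih => simp only [WS, ih]; rw [Finset.sum_add_distrib]

theorem WS_msum {α : Type*} (m : ℕ) (M : Multiset α) (Φ : α → List (Fin N) → ℝ) :
    (M.map fun z => WS m (Φ z)).sum = WS m fun l => (M.map fun z => Φ z l).sum := by
  induction M using Multiset.induction with
  | empty => simp [WS_const]
  | cons a s ih => simp only [Multiset.map_cons, Multiset.sum_cons, WS_add, ih]

theorem WS_mul (m : ℕ) (c : ℝ) (Φ : List (Fin N) → ℝ) : WS m (fun l => c * Φ l) = c * WS m Φ := by
  induction m generalizing Φ with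
  | zero => rfl
  | succ m ih => simp only [WS, ih]; rw [Finset.mul_sum]

theorem WS_dW (m : ℕ) (d : Fin N → ℕ) : WS m (fun l => (dW d l : ℝ)) = ((∑ v, d v : ℕ) : ℝ) ^ m := by
  induction m with
  | zero => simp [WS, dW]
  | succ m ih =>
    simp only [WS]
    have : ∀ v : Fin N, WS m (fun l => (dW d (v :: l) : ℝ)) = (d v : ℝ) * ((∑ v, d v : ℕ) : ℝ) ^ m := by
      intro v
      rw [← ih, ← WS_mul]
      congr 1; funext l
      simp [dW]
    simp only [this]
    rw [← Finset.sum_mul, pow_succ]; push_cast; ring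

theorem preimT_sum (p q : Fin N → ℂ[X]) (k : SymX N → ℝ) (x : SymX N) :
    ((preimT p q x).map k).sum = ∑ v, ((fiber (p v) (q v) x.2).map fun z => k (consW v x.1, z)).sum := by
  unfold preimT
  have h1 : ∀ (s : Finset (Fin N)) (F : Fin N → Multiset (SymX N)),
      ((∑ v ∈ s, F v).map k).sum = ∑ v ∈ s, ((F v).map k).sum := by
    intro s F
    induction s using Finset.induction_on with
    | empty => simp
    | insert a s ha ih => rw [Finset.sum_insert ha, Finset.sum_insert ha, Multiset.map_add, Multiset.sum_add, ih]
  rw [h1]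
  simp only [Multiset.map_map, Function.comp_def]

theorem preimTn_succ_sum (p q : Fin N → ℂ[X]) (k : SymX N → ℝ) (m : ℕ) (x : SymX N) :
    ((preimTn p q (m+1) x).map k).sum =
      ∑ v, ((fiber (p v) (q v) x.2).map fun z => ((preimTn p q m (consW v x.1, z)).map k).sum).sum := by
  rw [preimTn, Multiset.map_bind, Multiset.sum_bind]
  exact preimT_sum p q (fun y => ((preimTn p q m y).map k).sum) x

theorem preimTn_sum (p q : Fin N → ℂ[X]) (k : SymX N → ℝ) (m : ℕ) (w : ℕ → Fin N) (z : Sphere) :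
    ((preimTn p q m (w, z)).map k).sum =
      WS m fun l => ((fibW (fun v => fiber (p v) (q v)) l z).map fun y => k (consAll l w, y)).sum := by
  induction m generalizing w z with
  | zero => simp [preimTn, WS, fibW, consAll]
  | succ m ih =>
    rw [preimTn_succ_sum]
    simp only [ih, WS]
    refine Finset.sum_congr rfl fun v _ => ?_
    rw [WS_msum]
    congr 1; funext l
    simp only [fibW, consAll, Multiset.map_bind, Multiset.sum_bind]

section Met
attribute [local instance] sphM

theorem mem_back (p q : Fin N → ℂ[X]) (hg : Good p q) (hA1 : NoSuperAttract p q) (m : ℕ) (x y : SymX N)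
    (hx : x ∈ juliaSet p q) (hy : y ∈ preimTn p q m x) : y ∈ juliaSet p q := by
  have H := rat_dyn p q hg hA1
  induction m generalizing x with
  | zero => simp [preimTn] at hy; rw [hy]; exact hx
  | succ m ih =>
    rw [preimTn, Multiset.mem_bind] at hy
    obtain ⟨a, ha, hy⟩ := hy
    refine ih a ?_ hy
    unfold preimT at ha
    rw [Multiset.mem_sum] at ha
    obtain ⟨v, -, ha⟩ := ha
    obtain ⟨z, hz, rfl⟩ := Multiset.mem_map.1 ha
    have h1 : ratEval (p v) (q v) z = x.2 := ((H.pf v).mem_iff _ _).1 hz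
    apply H.back
    have : TT (fun v => ratEval (p v) (q v)) (consW v x.1, z) = x := by
      have h0 : consW v x.1 0 = v := by simp [consW]
      simp only [TT, shiftW_consW, h0, h1]
    rw [this]; exact hx

theorem Sm_cont (p q : Fin N → ℂ[X]) (hg : Good p q) (hA1 : NoSuperAttract p q) (k : SymX N → ℝ) (hk : Continuous k)
    (m : ℕ) : Continuous fun x : SymX N => ((preimTn p q m x).map k).sum := by
  have H := rat_dyn p q hg hA1
  haveI : ∀ x : Sphere, (𝓝[≠] x).NeBot := sph_nebot
  induction m with
  | zero => simpa [preimTn] using hk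
  | succ m ih =>
    simp only [preimTn_succ_sum]
    refine continuous_finsetSum _ fun v _ => ?_
    have hc : Continuous fun x : (ℕ → Fin N) × Sphere => ((preimTn p q m (consW v x.1, x.2)).map k).sum :=
      ih.comp (((consW_continuous v).comp continuous_fst).prodMk continuous_snd)
    exact (H.pf v).continuous_sum (fun x : (ℕ → Fin N) × Sphere => ((preimTn p q m (consW v x.1, x.2)).map k).sum) hc
end Met

theorem cyl_cover (k : C((ℕ → Fin N) × Sphere, ℝ)) (ε : ℝ) (hε : 0 < ε) :
    ∃ (Z : Finset (ℕ → Fin N)) (n0 : ℕ), ∀ w w' : ℕ → Fin N, (∀ n < n0, w n = w' n) →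
      ∃ w1 ∈ Z, ∀ y, |k (w, y) - k (w1, y)| ≤ ε ∧ |k (w', y) - k (w1, y)| ≤ ε := by
  have h1 : ∀ w : ℕ → Fin N, ∃ n : ℕ, ∀ w', (∀ i < n, w' i = w i) → ∀ y, |k (w', y) - k (w, y)| ≤ ε := by
    intro w
    have hU : {w' : ℕ → Fin N | dist (k.curry w') (k.curry w) < ε} ∈ 𝓝 w :=
      (k.curry.continuous.tendsto w) (Metric.ball_mem_nhds _ hε)
    obtain ⟨s, ⟨x, n, rfl⟩, hws, hs⟩ := (PiNat.isTopologicalBasis_cylinders (fun _ => Fin N)).mem_nhds_iff.1 hU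
    refine ⟨n, fun w' hw' y => ?_⟩
    have h2 : w' ∈ PiNat.cylinder x n := by
      rw [PiNat.mem_cylinder_iff] at hws ⊢
      intro i hi; rw [hw' i hi, hws i hi]
    have h3 : dist (k.curry w') (k.curry w) < ε := hs h2
    have h4 := ContinuousMap.dist_apply_le_dist (f := k.curry w') (g := k.curry w) y
    rw [Real.dist_eq] at h4
    exact h4.trans h3.le
  choose n hn using h1
  have hnh : ∀ w ∈ (Set.univ : Set (ℕ → Fin N)), PiNat.cylinder w (n w) ∈ 𝓝 w := fun w _ =>
    (PiNat.isOpen_cylinder (fun _ => Fin N) w (n w)).mem_nhds (PiNat.self_mem_cylinder w (n w))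
  obtain ⟨Z, -, hZ⟩ := isCompact_univ.elim_nhds_subcover (fun w => PiNat.cylinder w (n w)) hnh
  refine ⟨Z, Z.sup n, fun w w' hww => ?_⟩
  have := hZ (Set.mem_univ w)
  simp only [Set.mem_iUnion] at this
  obtain ⟨w1, hw1, hm⟩ := this
  rw [PiNat.mem_cylinder_iff] at hm
  refine ⟨w1, hw1, fun y => ⟨hn w1 w hm y, hn w1 w' (fun i hi => ?_) y⟩⟩
  rw [← hww i (hi.trans_le (Finset.le_sup hw1)), hm i hi]

section Met2
attribute [local instance] sphM

theorem osc_small (p q : Fin N → ℂ[X]) (hg : Good p q) (hA1 : NoSuperAttract p q)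
    (k : C((ℕ → Fin N) × Sphere, ℝ)) (ε : ℝ) (hε : 0 < ε) :
    ∃ m0 : ℕ, ∀ m, m0 ≤ m → ∀ x ∈ juliaSet p q, ∀ x' ∈ juliaSet p q,
      |GmFun p q k m x - GmFun p q k m x'| ≤ 4 * ε := by
  have H := rat_dyn p q hg hA1
  obtain ⟨hN, hc, hd, v0, hd2⟩ := hg
  have hDN : N < Dtot p q := by
    have : ∑ v : Fin N, 1 < ∑ v : Fin N, degR p q v :=
      Finset.sum_lt_sum (fun v _ => hd v) ⟨v0, Finset.mem_univ _, hd2⟩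
    simpa [Dtot] using this
  have hN0 : (0:ℝ) < N := by exact_mod_cast hN
  have hD0 : (0:ℝ) < Dtot p q := by exact_mod_cast (by omega : 0 < Dtot p q)
  set ρ : ℝ := (Dtot p q : ℝ) / N with hρdef
  have hρ : 1 < ρ := by
    rw [hρdef, one_lt_div hN0]; exact_mod_cast hDN
  obtain ⟨Z, n0, hZ⟩ := cyl_cover k ε hε
  have hcl : ∀ w1 : ℕ → Fin N, Cl (fun v => fiber (p v) (q v)) (degR p q) (juliaSet p q) ρ (fun y => k (w1, y)) :=
    fun w1 => cl_cont H ρ hρ _ (k.continuous.comp (by fun_prop))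
  choose mm hmm using fun w1 => hcl w1 ε hε
  refine ⟨max n0 (Z.sup mm), fun m hm x hx x' hx' => ?_⟩
  obtain ⟨w, z⟩ := x
  obtain ⟨w', z'⟩ := x'
  have key : |((preimTn p q m (w, z)).map k).sum - ((preimTn p q m (w', z')).map k).sum|
      ≤ WS m fun l => 3 * ε * (dW (degR p q) l : ℝ) + ε * ρ ^ m := by
    rw [preimTn_sum, preimTn_sum]
    refine WS_close m _ _ _ fun l hl => ?_
    obtain ⟨w1, hw1, hcw⟩ := hZ (consAll l w) (consAll l w') (fun n hn =>
      consAll_agree l w w' 0 (fun n hn => absurd hn (Nat.not_lt_zero _)) n (by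
        have := (le_max_left n0 (Z.sup mm)).trans hm
        omega))
    have h1 := msum_close (fibW (fun v => fiber (p v) (q v)) l z) (fun y => k (consAll l w, y)) (fun y => k (w1, y)) ε
      fun y _ => (hcw y).1
    have h2 := msum_close (fibW (fun v => fiber (p v) (q v)) l z') (fun y => k (consAll l w', y)) (fun y => k (w1, y)) ε
      fun y _ => (hcw y).2
    rw [(PF.word H.pf l).card] at h1 h2
    have h3 := hmm w1 l (by
      have := (le_max_right n0 (Z.sup mm)).trans hm
      have h4 : mm w1 ≤ Z.sup mm := Finset.le_sup hw1
      omega) _ hx _ hx'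
    unfold SumW at h3
    rw [hl] at h3
    simp only at h3
    rw [abs_le] at *
    constructor <;> linarith [h1.1, h1.2, h2.1, h2.2, h3.1, h3.2]
  rw [WS_add, WS_mul, WS_const, WS_dW] at key
  have hD : ((∑ v, degR p q v : ℕ) : ℝ) = Dtot p q := rfl
  rw [hD] at key
  have e : (N : ℝ) ^ m * (ε * ρ ^ m) = ε * (Dtot p q : ℝ) ^ m := by
    rw [hρdef, div_pow]; field_simp
  rw [e] at key
  unfold GmFun
  rw [← mul_sub, abs_mul, abs_of_pos (by positivity), inv_mul_le_iff₀ (by positivity)]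
  linarith

end Met2

theorem equicont_aux (p q : Fin N → ℂ[X]) (hg : Good p q) (hA1 : NoSuperAttract p q)
    (h : C(↥(juliaSet p q), ℝ)) :
    Equicontinuous (fun (m : ℕ) (x : ↥(juliaSet p q)) => GmFun p q (jextend p q ⇑h) m (x : SymX N)) := by
  obtain ⟨k, hk⟩ := ContinuousMap.exists_restrict_eq (isClosed_closure : IsClosed (juliaSet p q)) h
  have hk' : ∀ x (hx : x ∈ juliaSet p q), k x = h ⟨x, hx⟩ := fun x hx => by rw [← hk]; rfl
  have e : ∀ (m : ℕ) (x : ↥(juliaSet p q)), GmFun p q (jextend p q ⇑h) m (x : SymX N) = GmFun p q k m (x : SymX N) := by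
    intro m x
    unfold GmFun
    congr 2
    refine Multiset.map_congr rfl fun y hy => ?_
    have hyJ := mem_back p q hg hA1 m x y x.2 hy
    rw [hk' y hyJ]; simp [jextend, hyJ]
  simp only [e]
  intro x0
  rw [Metric.equicontinuousAt_iff_right]
  intro ε hε
  obtain ⟨m0, hm0⟩ := osc_small p q hg hA1 k (ε / 8) (by positivity)
  have hfin : ∀ᶠ x : ↥(juliaSet p q) in 𝓝 x0, ∀ m ∈ Finset.range m0, dist (GmFun p q k m (x0 : SymX N)) (GmFun p q k m (x : SymX N)) < ε := by
    rw [Filter.eventually_all_finset]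
    intro m _
    have hc : Continuous fun x : ↥(juliaSet p q) => GmFun p q k m (x : SymX N) :=
      continuous_const.mul ((Sm_cont p q hg hA1 k k.continuous m).comp continuous_subtype_val)
    have := hc.tendsto x0 (Metric.ball_mem_nhds _ hε)
    filter_upwards [this] with x hx
    rw [dist_comm]; exact hx
  filter_upwards [hfin] with x hx m
  by_cases hm : m < m0
  · exact hx m (Finset.mem_range.2 hm)
  · rw [Real.dist_eq]
    have := hm0 m (not_lt.1 hm) _ x0.2 _ x.2
    linarith
end Assembly

theorem equicontinuity_of_averaging_operator
    (hg : Good p q) (hA1 : NoSuperAttract p q) (h : C(↥(juliaSet p q), ℝ)) :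
    Equicontinuous
      (fun (m : ℕ) (x : ↥(juliaSet p q)) => GmFun p q (jextend p q ⇑h) m (x : SymX N)) := by
  exact equicont_aux p q hg hA1 h

end SkewRational
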